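/- Fix a total ordering of the odd cycles of Ḡ, and define f : Π_1 → Π_1 as follows: for π ∈ Π_1, let C be the first odd cycle that is a connected component of D_π; f(π) is obtained from π by, for each ē ∈ E(C): if T_ē is trivial, interchanging the labels 0 and 2 on its two flags; if T_ē ∈ 𝒯^D_odd, replacing the restriction π_20 by π_02 or π_02 by π_20; and if T_ē ∈ 𝒯^D_even, replacing ρ_20 by ρ_02 or ρ_02 by ρ_20. Then f is a well-defined fixed-point-free involution of Π_1 satisfying sgn(f(π)) = −sgn(π) for every π ∈ Π_1. -/

import Mathlib

namespace FLL

/-! ### Multigraphs -/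

variable {V E : Type}

/-- The flags of a multigraph: incident (vertex, edge) pairs. -/
def Flag (ends : E → Sym2 V) : Type := {p : V × E // p.1 ∈ ends p.2}

instance (ends : E → Sym2 V) [Fintype V] [Fintype E] [DecidableEq V] :
    Fintype (Flag ends) := Subtype.fintype _

/-- Degree of a vertex: number of incident edges. -/
def deg [Fintype E] [DecidableEq V] (ends : E → Sym2 V) (v : V) : ℕ :=
  (Finset.univ.filter fun e => v ∈ ends e).card

/-- A multigraph is loopless if no edge joins a vertex to itself. -/
def Loopless (ends : E → Sym2 V) : Prop := ∀ e, ¬ (ends e).IsDiag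

/-- A proper edge colouring: edges sharing an endpoint receive distinct colours. -/
def ProperEdgeColoring (ends : E → Sym2 V) (c : E → ℕ) : Prop :=
  ∀ e e', e ≠ e' → (∃ v, v ∈ ends e ∧ v ∈ ends e') → c e ≠ c e'

/-- `G` is `f`-edge choosable. -/
def EdgeChoosable (ends : E → Sym2 V) (f : E → ℕ) : Prop :=
  ∀ L : E → Finset ℕ, (∀ e, f e ≤ (L e).card) →
    ∃ c : E → ℕ, ProperEdgeColoring ends c ∧ ∀ e, c e ∈ L e

/-- Reachability avoiding a set `X` of edges. -/
def ReachAvoiding (ends : E → Sym2 V) (X : Set E) : V → V → Prop :=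
  Relation.ReflTransGen (fun u v => ∃ e, e ∉ X ∧ ends e = s(u, v))

/-- A cut-edge: its removal disconnects its two endpoints. -/
def IsCutEdge (ends : E → Sym2 V) (e : E) : Prop :=
  ∀ u v : V, ends e = s(u, v) → ¬ ReachAvoiding ends {e} u v

/-- Connectivity of the multigraph. -/
def ConnectedG (ends : E → Sym2 V) : Prop :=
  ∀ u v : V, ReachAvoiding ends ∅ u v

/-- A planar embedding of a loopless multigraph. -/
structure PlanarEmbedding (ends : E → Sym2 V) where
  vpos : V → ℝ × ℝ
  vinj : Function.Injective vpos
  arc : E → ℝ → ℝ × ℝ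
  arc_cont : ∀ e, ContinuousOn (arc e) (Set.Icc 0 1)
  arc_inj : ∀ e, Set.InjOn (arc e) (Set.Icc 0 1)
  arc_ends : ∀ e, Sym2.map vpos (ends e) = s(arc e 0, arc e 1)
  arc_avoid : ∀ e, ∀ t ∈ Set.Ioo (0:ℝ) 1, ∀ v, arc e t ≠ vpos v
  arc_disjoint : ∀ e e', e ≠ e' → ∀ t ∈ Set.Ioo (0:ℝ) 1, ∀ t' ∈ Set.Ioo (0:ℝ) 1,
    arc e t ≠ arc e' t'

variable [Fintype V] [DecidableEq V] [Fintype E] [DecidableEq E]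

/-- A star labelling of `G`: at each vertex `v` the labels of the flags at `v` form a
bijection onto `{0, 1, …, deg v − 1}`. -/
def IsStarLabelling (ends : E → Sym2 V) (π : Flag ends → ℕ) : Prop :=
  ∀ v : V, (Finset.univ.filter (fun fl : Flag ends => fl.1.1 = v)).image π
      = Finset.range (deg ends v)

/-- The exponent of a star labelling: `w_π(e) = π_u(e) + π_v(e)` for `e = uv`. -/
def exponent (ends : E → Sym2 V) (π : Flag ends → ℕ) : E → ℕ :=
  fun e => ∑ fl ∈ Finset.univ.filter (fun fl : Flag ends => fl.1.2 = e), π fl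

/-- The sign of a star labelling relative to a fixed linear ordering of the edges. -/
def starSign [LinearOrder E] (ends : E → Sym2 V) (π : Flag ends → ℕ) : ℤ :=
  ∏ p ∈ Finset.univ.filter
      (fun p : Flag ends × Flag ends => p.1.1.1 = p.2.1.1 ∧ p.1.1.2 < p.2.1.2),
    Int.sign ((π p.2 : ℤ) - (π p.1 : ℤ))

/-! ### Threads -/

/-- Flags of the thread `T_m`:
`vLeft k = (v_k, e_k)`, `vRight k = (v_{k+1}, e_k)` for `0 ≤ k ≤ m`;
`vFoot k = (v_{k+1}, f_{k+1})`, `wFoot k = (w_{k+1}, f_{k+1})` for `0 ≤ k ≤ m−1`. -/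
inductive ThreadFlag (m : ℕ) where
  | vLeft (k : Fin (m+1))
  | vRight (k : Fin (m+1))
  | vFoot (k : Fin m)
  | wFoot (k : Fin m)
deriving DecidableEq

/-- Edges of the thread `T_m`: path edges `e k` (`0 ≤ k ≤ m`) and feet `f k`
(`f k` being the foot edge `f_{k+1}`, `0 ≤ k ≤ m−1`). -/
inductive ThreadEdge (m : ℕ) where
  | e (k : Fin (m+1))
  | f (k : Fin m)
deriving DecidableEq

namespace Thread

variable {m : ℕ}

/-- The edge a thread flag sits on. -/
def edgeOfFlag : ThreadFlag m → ThreadEdge m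
  | .vLeft k => .e k
  | .vRight k => .e k
  | .vFoot k => .f k
  | .wFoot k => .f k

/-- The vertex a thread flag sits on: `inl i` is `v_i`, `inr k` is `w_{k+1}`. -/
def tvert : ThreadFlag m → ℕ ⊕ ℕ
  | .vLeft k => .inl k
  | .vRight k => .inl (k + 1)
  | .vFoot k => .inl (k + 1)
  | .wFoot k => .inr k

/-- The constant weighting `w_𝟐 ≡ 2`. -/
def w2 : ThreadEdge m → ℕ := fun _ => 2

/-- The weighting `w_11`: as `w_𝟐` except `w(e_0) = 1`, `w(e_m) = 3`. -/
def w11 : ThreadEdge m → ℕ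
  | .e k => if (k : ℕ) = 0 then 1 else if (k : ℕ) = m then 3 else 2
  | .f _ => 2

/-- The weighting `w_02`: as `w_𝟐` except `w(e_0) = 1`, `w(f_1) = 3`. -/
def w02 : ThreadEdge m → ℕ
  | .e k => if (k : ℕ) = 0 then 1 else 2
  | .f k => if (k : ℕ) = 0 then 3 else 2

/-- The weighting `w_20`: as `w_𝟐` except `w(e_0) = 3`, `w(e_1) = 0`, `w(f_1) = 3`. -/
def w20 : ThreadEdge m → ℕ
  | .e k => if (k : ℕ) = 0 then 3 else if (k : ℕ) = 1 then 0 else 2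
  | .f k => if (k : ℕ) = 0 then 3 else 2

/-- The 1-footed prestar labelling `ρ_02`. -/
def rho02 : ThreadFlag m → Fin 3
  | .vLeft _ => 0 | .vRight _ => 2 | .vFoot _ => 1 | .wFoot _ => 1

/-- The 1-footed prestar labelling `ρ_20`. -/
def rho20 : ThreadFlag m → Fin 3
  | .vLeft _ => 2 | .vRight _ => 0 | .vFoot _ => 1 | .wFoot _ => 1

/-- The prestar labelling `ρ_11` of the trivial thread `T_0`. -/
def rho11 : ThreadFlag m → Fin 3 := fun _ => 1

/-- The 1-footed prestar labelling `π_11` (for `m ≥ 1`). -/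
def pi11 : ThreadFlag m → Fin 3
  | .vLeft k => if (k : ℕ) = 0 then 1 else 2
  | .vRight k => if (k : ℕ) = m then 1 else 0
  | .vFoot _ => 1 | .wFoot _ => 1

/-- The 1-footed prestar labelling `π_02` (for `m ≥ 1`). -/
def pi02 : ThreadFlag m → Fin 3
  | .vLeft _ => 0
  | .vRight k => if (k : ℕ) = 0 then 1 else 2
  | .vFoot k => if (k : ℕ) = 0 then 2 else 1
  | .wFoot _ => 1

/-- The 1-footed prestar labelling `π_20` (for `m ≥ 1`). -/
def pi20 : ThreadFlag m → Fin 3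
  | .vLeft k => if (k : ℕ) = 1 then 0 else 2
  | .vRight k => if (k : ℕ) = 0 then 1 else 0
  | .vFoot k => if (k : ℕ) = 0 then 2 else 1
  | .wFoot _ => 1

/-- The exceptional 1-footed prestar labelling `π′_11` of `T_1`. -/
def pi'11 : ThreadFlag m → Fin 3
  | .vLeft _ => 1
  | .vRight k => if (k : ℕ) = 0 then 0 else 1
  | .vFoot _ => 2 | .wFoot _ => 1

end Thread

/-! ### General threads: open, closed and injured -/

/-- The isomorphism type of a general thread: a thread `T_m`, a closed thread `T_m^∘`
(`v_0` identified with `v_{m+1}`), or an injured thread `T_m^−` (the foot vertex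
`w_{k+1}` deleted). -/
inductive GK where
  | openT (m : ℕ)
  | closedT (m : ℕ)
  | injuredT (m : ℕ) (k : Fin m)
deriving DecidableEq

/-- The order of a general thread. -/
def GK.order : GK → ℕ
  | .openT m => m
  | .closedT m => m
  | .injuredT m _ => m

/-- The flags of a general thread of the given isomorphism type. -/
def KFlag : GK → Type
  | .openT m => ThreadFlag m
  | .closedT m => ThreadFlag m
  | .injuredT m k => {fl : ThreadFlag m // fl ≠ .vFoot k ∧ fl ≠ .wFoot k}

/-- The edges of a general thread of the given isomorphism type. -/
def KEdge : GK → Type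
  | .openT m => ThreadEdge m
  | .closedT m => ThreadEdge m
  | .injuredT m k => {a : ThreadEdge m // a ≠ .f k}

/-- Inclusion of the flags of a general thread into those of the underlying `T_m`. -/
def flagProj : (g : GK) → KFlag g → ThreadFlag g.order
  | .openT _, fl => fl
  | .closedT _, fl => fl
  | .injuredT _ _, fl => fl.1

/-- Inclusion of the edges of a general thread into those of the underlying `T_m`. -/
def edgeProj : (g : GK) → KEdge g → ThreadEdge g.order
  | .openT _, a => a
  | .closedT _, a => a
  | .injuredT _ _, a => a.1

/-- The edge of a flag of a general thread. -/
def kedgeOf : (g : GK) → KFlag g → KEdge g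
  | .openT _, fl => Thread.edgeOfFlag fl
  | .closedT _, fl => Thread.edgeOfFlag fl
  | .injuredT m k, fl => ⟨Thread.edgeOfFlag fl.1, by
      obtain ⟨fl, h1, h2⟩ := fl
      cases fl <;> simp_all [Thread.edgeOfFlag] <;>
        rintro rfl <;> simp_all⟩

/-- The vertex of a flag of a general thread (`inl i` is `v_i`, `inr k` is `w_{k+1}`);
in a closed thread, `v_{m+1}` is identified with `v_0`. -/
def kvert : (g : GK) → KFlag g → ℕ ⊕ ℕ
  | .openT _, fl => Thread.tvert fl
  | .closedT m, fl => match Thread.tvert fl with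
      | .inl i => .inl (i % (m + 1))
      | .inr i => .inr i
  | .injuredT _ _, fl => Thread.tvert fl.1

/-- The head flag `v_0 e_0` of a general thread. -/
def headFlag : (g : GK) → KFlag g
  | .openT _ => .vLeft 0
  | .closedT _ => .vLeft 0
  | .injuredT _ _ => ⟨.vLeft 0, by simp⟩

/-- The tail flag `v_{m+1} e_m` of a general thread. -/
def tailFlag : (g : GK) → KFlag g
  | .openT m => .vRight (Fin.last m)
  | .closedT m => .vRight (Fin.last m)
  | .injuredT m _ => ⟨.vRight (Fin.last m), by simp⟩

/-- The eight classes of general threads: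
`𝒯^1` (extended vertex blocks), `𝒯^∘_odd`, `𝒯^∘_even` (extended cycle blocks),
`𝒯^M_0`, `𝒯^M_{≥1}` (threads of the derived graph whose edge lies in `M`),
`𝒯^D_odd`, `𝒯^D_even`, `𝒯^D_0` (threads whose edge lies in the 2-factor `D`). -/
inductive TClass where
  | t1 | circOdd | circEven | m0 | mge1 | dOdd | dEven | d0
deriving DecidableEq

open Thread in
open Classical in
/-- The restriction of the weighting `w_S` to a general thread of class `c`
(`inS` records whether the thread belongs to `S ⊆ 𝒯^D_odd`):  `w_11` on
`𝒯^M_{≥1} ∪ 𝒯^1`, `w_20` on `S`, `w_02` on `(𝒯^D_odd − S) ∪ 𝒯^∘_even`, and `w_𝟐`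
otherwise. -/
noncomputable def clsWeight (c : TClass) (inS : Prop) (m : ℕ) : ThreadEdge m → ℕ :=
  match c with
  | .t1 => w11
  | .mge1 => w11
  | .dOdd => if inS then w20 else w02
  | .circEven => w02
  | _ => w2

/-! ### The thread decomposition of a connected planar cubic graph -/

open Thread

/-- A connected loopless planar cubic graph `G` together with its decomposition into
general threads (Section 4 of the paper): a root proper block has been chosen, the edge
sets of the general threads (extended vertex blocks `≅ T_1^−`, extended cycle blocks
`≅ T_m^∘`, and the threads `T_ē ≅ T_m` or `T_m^−` coming from the edges `ē` of the
derived graph `Ḡ`) partition `E(G)`, and every general thread has been classified into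
one of the eight classes of \eqref{eq:allThreads} according to the perfect matching `M`
of `Ḡ` and its complementary bipartite 2-factor `D`.  The field `emb` records, for each
general thread, the identification of its flags with flags of `G` (the choice of head
being built in), `eemb` does the same for edges, and the remaining fields record the
defining properties of the construction. -/
structure Setup where
  /-- vertices of `G` -/
  V : Type
  /-- edges of `G` -/
  E : Type
  [fintypeV : Fintype V]
  [decEqV : DecidableEq V]
  [fintypeE : Fintype E]
  [decEqE : DecidableEq E]
  /-- the fixed ordering of `E(G)` (used for signs) -/
  [linOrdE : LinearOrder E]
  /-- the incidence of `G` -/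
  ends : E → Sym2 V
  loopless : Loopless ends
  cubic : ∀ v, deg ends v = 3
  connected : ConnectedG ends
  planar : Nonempty (PlanarEmbedding ends)
  /-- index set of the general threads -/
  ι : Type
  [fintypeι : Fintype ι]
  [decEqι : DecidableEq ι]
  /-- the isomorphism type of each general thread -/
  kind : ι → GK
  /-- the class of each general thread -/
  cls : ι → TClass
  /-- the identification of the flags of each general thread with flags of `G` -/
  emb : (t : ι) → KFlag (kind t) → Flag ends
  /-- the identification of the edges of each general thread with edges of `G` -/
  eemb : (t : ι) → KEdge (kind t) → E
  emb_inj : ∀ t, Function.Injective (emb t)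
  /-- the flags of the general threads partition the flags of `G` -/
  flag_partition : ∀ fl : Flag ends, ∃! p : Σ t : ι, KFlag (kind t), emb p.1 p.2 = fl
  /-- `emb` and `eemb` are compatible -/
  emb_edge : ∀ t fl, (emb t fl).1.2 = eemb t (kedgeOf (kind t) fl)
  eemb_inj : Function.Injective (fun p : Σ t : ι, KEdge (kind t) => eemb p.1 p.2)
  /-- two flags of a general thread lie at the same vertex of the thread iff their
  images lie at the same vertex of `G` -/
  emb_vert : ∀ t fl fl', kvert (kind t) fl = kvert (kind t) fl' ↔
      (emb t fl).1.1 = (emb t fl').1.1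
  /-- the feet of the general threads lie on cut-edges of `G` -/
  foot_cut : ∀ t (a : KEdge (kind t)), (∃ k, edgeProj (kind t) a = .f k) →
      IsCutEdge ends (eemb t a)
  /-- `𝒯^1`: extended vertex blocks, copies of the injured thread `T_1^−` -/
  cls_t1 : ∀ t, cls t = .t1 → kind t = .injuredT 1 0
  /-- `𝒯^∘_odd`: extended cycle blocks `≅ T_m^∘` with `m` odd -/
  cls_circOdd : ∀ t, cls t = .circOdd → ∃ m, Odd m ∧ kind t = .closedT m
  /-- `𝒯^∘_even`: extended cycle blocks `≅ T_m^∘` with `m` even (`m ≥ 1`) -/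
  cls_circEven : ∀ t, cls t = .circEven → ∃ m, Even m ∧ 1 ≤ m ∧ kind t = .closedT m
  /-- `𝒯^M_0`: trivial threads whose derived edge lies in `M` -/
  cls_m0 : ∀ t, cls t = .m0 → kind t = .openT 0
  /-- `𝒯^D_0`: trivial threads whose derived edge lies in `D` -/
  cls_d0 : ∀ t, cls t = .d0 → kind t = .openT 0
  /-- `𝒯^M_{≥1}`: nontrivial threads whose derived edge lies in `M` -/
  cls_mge1 : ∀ t, cls t = .mge1 →
      (∃ m, 1 ≤ m ∧ kind t = .openT m) ∨ (∃ m k, kind t = .injuredT m k)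
  /-- `𝒯^D_odd`: odd-order threads whose derived edge lies in `D` -/
  cls_dOdd : ∀ t, cls t = .dOdd → ∃ m, Odd m ∧ kind t = .openT m
  /-- `𝒯^D_even`: even-order (`≥ 2`) threads whose derived edge lies in `D` -/
  cls_dEven : ∀ t, cls t = .dEven → ∃ m, Even m ∧ 2 ≤ m ∧ kind t = .openT m
  /-- closed threads are the extended cycle blocks -/
  closed_cls : ∀ t m, kind t = GK.closedT m → cls t = .circOdd ∨ cls t = .circEven
  /-- every injured thread belongs to `𝒯^M_{≥1} ∪ 𝒯^1`; in particular every base edge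
  of `Ḡ` lies in the matching `M` (property (1) of the choice of `M`) -/
  injured_cls : ∀ t m k, kind t = GK.injuredT m k → cls t = .t1 ∨ cls t = .mge1

attribute [instance] Setup.fintypeV Setup.decEqV Setup.fintypeE Setup.decEqE
  Setup.linOrdE Setup.fintypeι Setup.decEqι

namespace Setup

variable (St : Setup)

/-- The general threads arising from edges of the derived graph `Ḡ`. -/
def isEdgeThread (t : St.ι) : Prop :=
  St.cls t = .m0 ∨ St.cls t = .mge1 ∨ St.cls t = .dOdd ∨ St.cls t = .dEven ∨
    St.cls t = .d0

/-- The perfect matching `M` of `Ḡ`, as a set of edge threads. -/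
def inM (t : St.ι) : Prop := St.cls t = .m0 ∨ St.cls t = .mge1

/-- The 2-factor `D = E(Ḡ) − M`, as a set of edge threads. -/
def inD (t : St.ι) : Prop := St.cls t = .dOdd ∨ St.cls t = .dEven ∨ St.cls t = .d0

/-- The vertex of `G` at the head of a general thread; for edge threads this is an
endpoint of the corresponding edge `ē` of `Ḡ`. -/
def headV (t : St.ι) : St.V := (St.emb t (headFlag (St.kind t))).1.1

/-- The vertex of `G` at the tail of a general thread. -/
def tailV (t : St.ι) : St.V := (St.emb t (tailFlag (St.kind t))).1.1

/-- The branch vertices, i.e. the vertices of the derived graph `Ḡ`. -/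
def branchV : Set St.V :=
  {v | ∃ t, St.isEdgeThread t ∧ (St.headV t = v ∨ St.tailV t = v)}

/-- The number of edge-ends of threads satisfying `P` incident with `v`. -/
noncomputable def endCount (P : St.ι → Prop) (v : St.V) : ℕ :=
  {p : St.ι × Bool | P p.1 ∧ (if p.2 then St.tailV p.1 else St.headV p.1) = v}.ncard

/-- The defining properties of the matching `M`, the bipartite 2-factor `D` and its
cyclic orientation `D⃗` used in the construction:  `M` is a perfect matching of `Ḡ`
whose complement `D` is a 2-factor; `D` is bipartite; subject to the stated conditions
`M` carries the maximum number of nontrivial threads; and `D` has a cyclic orientation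
`D⃗` such that the head of every thread in `𝒯^D_odd` is the head of its edge in `D⃗`. -/
def MatchingHyps : Prop :=
  (∀ t, St.isEdgeThread t → St.headV t ≠ St.tailV t) ∧
  -- `M` is a perfect matching of `Ḡ` (each branch vertex meets exactly one `M`-end)
  (∀ v ∈ St.branchV, St.endCount St.inM v = 1) ∧
  -- `D` is a 2-factor of `Ḡ`
  (∀ v ∈ St.branchV, St.endCount St.inD v = 2) ∧
  -- (2) `D` is bipartite
  (∃ c : St.V → Bool, ∀ t, St.inD t → c (St.headV t) ≠ c (St.tailV t)) ∧
  -- (3) subject to (1) and (2), `M` has as many nontrivial threads as possible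
  (∀ M' : St.ι → Prop, (∀ t, M' t → St.isEdgeThread t) →
    (∀ t m k, St.kind t = GK.injuredT m k → St.isEdgeThread t → M' t) →
    (∀ v ∈ St.branchV, St.endCount M' v = 1) →
    (∀ v ∈ St.branchV, St.endCount (fun t => St.isEdgeThread t ∧ ¬ M' t) v = 2) →
    (∃ c : St.V → Bool, ∀ t, St.isEdgeThread t → ¬ M' t →
        c (St.headV t) ≠ c (St.tailV t)) →
    {t | M' t ∧ 1 ≤ (St.kind t).order}.ncard ≤
      {t | St.inM t ∧ 1 ≤ (St.kind t).order}.ncard) ∧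
  -- the cyclic orientation `D⃗` of `D`; `hd t = true` means `ē` points towards `headV t`
  (∃ hd : St.ι → Bool,
    (∀ v ∈ St.branchV,
      {t | St.inD t ∧ (if hd t then St.headV t else St.tailV t) = v}.ncard = 1) ∧
    (∀ v ∈ St.branchV,
      {t | St.inD t ∧ (if hd t then St.tailV t else St.headV t) = v}.ncard = 1) ∧
    (∀ t, St.cls t = .dOdd → hd t = true))

/-- Membership in `Π_S`: a star labelling of `G` whose exponent is the weighting `w_S`. -/
noncomputable def PiS (S : Set St.ι) (π : Flag St.ends → ℕ) : Prop :=
  IsStarLabelling St.ends π ∧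
  ∀ t (a : KEdge (St.kind t)),
    exponent St.ends π (St.eemb t a) =
      clsWeight (St.cls t) (t ∈ S) (St.kind t).order (edgeProj (St.kind t) a)

/-- Membership in `Π = ⋃ {Π_S : S ⊆ 𝒯^D_odd}`. -/
noncomputable def PiMem (π : Flag St.ends → ℕ) : Prop :=
  ∃ S : Set St.ι, (∀ t ∈ S, St.cls t = .dOdd) ∧ St.PiS S π

/-- The restriction of `π` to the flags of the general thread `t` equals the prestar
labelling `ν` (given uniformly in the order `m`). -/
def RestrEq (t : St.ι) (π : Flag St.ends → ℕ)
    (ν : (m : ℕ) → ThreadFlag m → Fin 3) : Prop :=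
  ∀ fl : KFlag (St.kind t),
    π (St.emb t fl) = (ν (St.kind t).order (flagProj (St.kind t) fl) : ℕ)

/-- The restriction of `π` to the flags of `t` is the exceptional labelling `π′_11`
of `T_1`. -/
def RestrIsPi'11 (t : St.ι) (π : Flag St.ends → ℕ) : Prop :=
  St.kind t = GK.openT 1 ∧ St.RestrEq t π (fun _ => pi'11)

/-- The perfect matching `M_π` of `Ḡ` derived from `π ∈ Π`: the edge threads whose
head and tail flags are both labelled `1` (i.e. whose type is `(1,1)`). -/
def MpiT (π : Flag St.ends → ℕ) : Set St.ι :=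
  {t | St.isEdgeThread t ∧ π (St.emb t (headFlag (St.kind t))) = 1 ∧
    π (St.emb t (tailFlag (St.kind t))) = 1}

/-- The complementary 2-factor `D_π = E(Ḡ) − M_π`. -/
def DpiT (π : Flag St.ends → ℕ) : Set St.ι :=
  {t | St.isEdgeThread t ∧ t ∉ St.MpiT π}

/-- `D_π` is bipartite. -/
def DpiBipartite (π : Flag St.ends → ℕ) : Prop :=
  ∃ c : St.V → Bool, ∀ t ∈ St.DpiT π, c (St.headV t) ≠ c (St.tailV t)

/-- `Π_0`: the star labellings in `Π` whose 2-factor `D_π` is bipartite. -/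
noncomputable def Pi0 (π : Flag St.ends → ℕ) : Prop :=
  St.PiMem π ∧ St.DpiBipartite π

/-- `Π_1 = Π − Π_0`. -/
noncomputable def Pi1 (π : Flag St.ends → ℕ) : Prop :=
  St.PiMem π ∧ ¬ St.DpiBipartite π

/-- `C` is an odd cycle of the derived graph `Ḡ` (given as its set of edges). -/
def IsOddCycle (C : Set St.ι) : Prop :=
  (∀ t ∈ C, St.isEdgeThread t) ∧
  ∃ n : ℕ, Odd n ∧ ∃ (vs : Fin n → St.V) (es : Fin n → St.ι),
    Function.Injective vs ∧ Function.Injective es ∧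
    (∀ i, es i ∈ C) ∧ (∀ t ∈ C, ∃ i, es i = t) ∧
    (∀ i, s(St.headV (es i), St.tailV (es i)) = s(vs i, vs (finRotate n i)))

/-- `C` is a connected component of the subgraph of `Ḡ` with edge set `Dset`, and is
an odd cycle. -/
def IsOddCycleComponent (Dset C : Set St.ι) : Prop :=
  St.IsOddCycle C ∧ C ⊆ Dset ∧
  ∀ t ∈ C, ∀ t' ∈ Dset,
    (St.headV t' = St.headV t ∨ St.headV t' = St.tailV t ∨
     St.tailV t' = St.headV t ∨ St.tailV t' = St.tailV t) → t' ∈ C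

/-- `π⁰` is the reference star labelling: the unique member of `Π_∅` with `M_{π⁰} = M`
in which every closed thread of `𝒯^∘_odd` receives the labelling `ρ_02`. -/
noncomputable def IsReference (π : Flag St.ends → ℕ) : Prop :=
  St.PiS ∅ π ∧ St.MpiT π = {t | St.inM t} ∧
  ∀ t, St.cls t = .circOdd → St.RestrEq t π (fun _ => rho02)

end Setup
end FLL

open FLL FLL.Thread

/-- `π'` is obtained from `π` by the swap described in Proposition 5.7, performed on the
first odd cycle `C` (first with respect to the fixed total ordering `rk` of the odd
cycles of `Ḡ`) that is a connected component of `D_π`:  outside the threads of `C`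
nothing changes, and on each thread `T_ē`, `ē ∈ E(C)`:  if `T_ē` is trivial the labels
`0` and `2` on its two flags are interchanged; if `T_ē ∈ 𝒯^D_odd` the prestar
labellings `π_20` and `π_02` are interchanged; and if `T_ē ∈ 𝒯^D_even` the prestar
labellings `ρ_20` and `ρ_02` are interchanged. -/
def SwapSpec (St : FLL.Setup) (rk : Set St.ι → ℕ)
    (π π' : FLL.Flag St.ends → ℕ) : Prop :=
  ∃ C : Set St.ι,
    St.IsOddCycleComponent (St.DpiT π) C ∧
    (∀ C' : Set St.ι, St.IsOddCycleComponent (St.DpiT π) C' → rk C ≤ rk C') ∧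
    (∀ fl : FLL.Flag St.ends,
      (∀ t ∈ C, ∀ kf : KFlag (St.kind t), St.emb t kf ≠ fl) → π' fl = π fl) ∧
    (∀ t ∈ C, (St.kind t).order = 0 →
      ∀ kf : KFlag (St.kind t), π' (St.emb t kf) = 2 - π (St.emb t kf)) ∧
    (∀ t ∈ C, St.cls t = TClass.dOdd →
      (St.RestrEq t π (fun _ => pi20) → St.RestrEq t π' (fun _ => pi02)) ∧
      (St.RestrEq t π (fun _ => pi02) → St.RestrEq t π' (fun _ => pi20))) ∧
    (∀ t ∈ C, St.cls t = TClass.dEven →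
      (St.RestrEq t π (fun _ => rho20) → St.RestrEq t π' (fun _ => rho02)) ∧
      (St.RestrEq t π (fun _ => rho02) → St.RestrEq t π' (fun _ => rho20)))

namespace FLL
namespace Pf

/-! #### Transport of the thread embeddings along an identification of the kind -/

def embG {St : Setup} {t : St.ι} {g : GK} (h : St.kind t = g) (kf : KFlag g) : Flag St.ends :=
  St.emb t (cast (congrArg KFlag h.symm) kf)

def eembG {St : Setup} {t : St.ι} {g : GK} (h : St.kind t = g) (a : KEdge g) : St.E :=
  St.eemb t (cast (congrArg KEdge h.symm) a)

section transport
variable {St : Setup} {t : St.ι} {g : GK} (h : St.kind t = g)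
theorem embG_inj {x y : KFlag g} (hxy : embG h x = embG h y) : x = y := by
  subst h; exact St.emb_inj t hxy

theorem embG_edge (x : KFlag g) : (embG h x).1.2 = eembG h (kedgeOf g x) := by
  subst h; exact St.emb_edge t x

theorem embG_vert (x y : KFlag g) : kvert g x = kvert g y ↔ (embG h x).1.1 = (embG h y).1.1 := by
  subst h; exact St.emb_vert t x y

theorem embG_head : embG h (headFlag g) = St.emb t (headFlag (St.kind t)) := by
  subst h; rfl

theorem embG_tail : embG h (tailFlag g) = St.emb t (tailFlag (St.kind t)) := by
  subst h; rfl

theorem emb_exists (kf : KFlag (St.kind t)) : ∃ x : KFlag g, St.emb t kf = embG h x := by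
  subst h; exact ⟨kf, rfl⟩

theorem restrEq_iff (π : Flag St.ends → ℕ) (ν : (m : ℕ) → ThreadFlag m → Fin 3) :
    St.RestrEq t π ν ↔ ∀ x : KFlag g, π (embG h x) = (ν g.order (flagProj g x) : ℕ) := by
  subst h; exact Iff.rfl

theorem embG_eq_emb (x : KFlag g) : ∃ kf, embG h x = St.emb t kf := ⟨_, rfl⟩

theorem piS_G {S : Set St.ι} {π : Flag St.ends → ℕ} (hp : St.PiS S π) (a : KEdge g) :
    exponent St.ends π (eembG h a) = clsWeight (St.cls t) (t ∈ S) g.order (edgeProj g a) := by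
  subst h; exact hp.2 t a

theorem piS_of_G {S : Set St.ι} {π : Flag St.ends → ℕ}
    (hp : ∀ a : KEdge g, exponent St.ends π (eembG h a) =
      clsWeight (St.cls t) (t ∈ S) g.order (edgeProj g a)) (a : KEdge (St.kind t)) :
    exponent St.ends π (St.eemb t a) =
      clsWeight (St.cls t) (t ∈ S) (St.kind t).order (edgeProj (St.kind t) a) := by
  subst h; exact hp a

end transport

theorem emb_thread_unique {St : Setup} {t t' : St.ι} {x : KFlag (St.kind t)}
    {y : KFlag (St.kind t')} (h : St.emb t x = St.emb t' y) : t = t' := by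
  have := (St.flag_partition (St.emb t x)).unique (y₁ := ⟨t, x⟩) (y₂ := ⟨t', y⟩) rfl h.symm
  exact congrArg Sigma.fst this

theorem embG_thread_unique {St : Setup} {t t' : St.ι} {g g' : GK} {h : St.kind t = g}
    {h' : St.kind t' = g'} {x : KFlag g}
    {y : KFlag g'} (e : embG h x = embG h' y) : t = t' := emb_thread_unique e

theorem flag_exists {St : Setup} (fl : Flag St.ends) : ∃ t, ∃ kf, St.emb t kf = fl := by
  obtain ⟨p, hp, _⟩ := St.flag_partition fl
  exact ⟨p.1, p.2, hp⟩

/-! #### Elementary facts on star labellings -/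

theorem flag_ext {V E : Type} {ends : E → Sym2 V} {x y : Flag ends} (h1 : x.1.1 = y.1.1)
    (h2 : x.1.2 = y.1.2) : x = y := Subtype.ext (Prod.ext h1 h2)

theorem flagsAt_card (St : Setup) (v : St.V) :
    (Finset.univ.filter (fun fl : Flag St.ends => fl.1.1 = v)).card = 3 := by
  rw [← St.cubic v]
  unfold deg
  refine Finset.card_bij (fun fl _ => fl.1.2) ?_ ?_ ?_
  · intro a ha
    simp only [Finset.mem_filter, Finset.mem_univ, true_and] at ha ⊢
    rw [← ha]; exact a.2
  · intro a ha b hb hab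
    simp only [Finset.mem_filter, Finset.mem_univ, true_and] at ha hb
    exact flag_ext (ha.trans hb.symm) hab
  · intro e he
    simp only [Finset.mem_filter, Finset.mem_univ, true_and] at he
    exact ⟨⟨(v, e), he⟩, Finset.mem_filter.2 ⟨Finset.mem_univ _, rfl⟩, rfl⟩

section star
variable {St : Setup} {π : Flag St.ends → ℕ}

theorem star_le (hs : IsStarLabelling St.ends π) (fl : Flag St.ends) : π fl ≤ 2 := by
  have h := hs fl.1.1
  rw [St.cubic] at h
  have : π fl ∈ Finset.range 3 := by
    rw [← h]; exact Finset.mem_image_of_mem _ (by simp)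
  simp at this; omega

theorem star_inj (hs : IsStarLabelling St.ends π) {x y : Flag St.ends} (h1 : x.1.1 = y.1.1) (h2 : π x = π y) : x = y := by
  have h := hs x.1.1
  rw [St.cubic] at h
  have hc : ((Finset.univ.filter (fun fl : Flag St.ends => fl.1.1 = x.1.1)).image π).card
      = (Finset.univ.filter (fun fl : Flag St.ends => fl.1.1 = x.1.1)).card := by
    rw [h, flagsAt_card]; simp
  have hi := Finset.injOn_of_card_image_eq hc
  exact hi (by simp) (by simp [h1]) h2

theorem star_surj (hs : IsStarLabelling St.ends π) (v : St.V) (j : ℕ) (hj : j < 3) : ∃ fl : Flag St.ends, fl.1.1 = v ∧ π fl = j := by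
  have h := hs v
  rw [St.cubic] at h
  have : j ∈ Finset.range 3 := by simpa using hj
  rw [← h] at this
  simpa using this

theorem star_three (hs : IsStarLabelling St.ends π) {x y z u : Flag St.ends} (hxy : x ≠ y) (hxz : x ≠ z) (hyz : y ≠ z)
    (h1 : x.1.1 = y.1.1) (h2 : x.1.1 = z.1.1) (h3 : u.1.1 = x.1.1) : u = x ∨ u = y ∨ u = z := by
  have a1 := star_le hs x
  have a2 := star_le hs y
  have a3 := star_le hs z
  have a4 := star_le hs u
  have b1 : π x ≠ π y := fun h => hxy (star_inj hs h1 h)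
  have b2 : π x ≠ π z := fun h => hxz (star_inj hs h2 h)
  have b3 : π y ≠ π z := fun h => hyz (star_inj hs (h1.symm.trans h2) h)
  have : π u = π x ∨ π u = π y ∨ π u = π z := by omega
  rcases this with h | h | h
  · exact Or.inl (star_inj hs h3 h)
  · exact Or.inr (Or.inl (star_inj hs (h3.trans h1) h))
  · exact Or.inr (Or.inr (star_inj hs (h3.trans h2) h))

theorem star_sum (hs : IsStarLabelling St.ends π) (v : St.V) :
    ∑ fl ∈ Finset.univ.filter (fun fl : Flag St.ends => fl.1.1 = v), ((π fl : ℤ) - 1) = 0 := by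
  have hi : Set.InjOn π (Finset.univ.filter (fun fl : Flag St.ends => fl.1.1 = v)) := by
    intro a ha b hb hab
    simp at ha hb
    exact star_inj hs (ha.trans hb.symm) hab
  have := Finset.sum_image (f := fun n : ℕ => (n : ℤ) - 1) hi
  rw [← this, hs v, St.cubic]
  simp [Finset.sum_range_succ]

end star

theorem flag_other {St : Setup} {x y u : Flag St.ends} (hxy : x ≠ y) (h1 : x.1.2 = y.1.2)
    (h2 : u.1.2 = x.1.2) : u = x ∨ u = y := by
  have hv : x.1.1 ≠ y.1.1 := fun h => hxy (flag_ext h h1)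
  have hx := x.2
  have hy := y.2
  rw [← h1] at hy
  have hu := u.2
  rw [h2] at hu
  rw [(Sym2.mem_and_mem_iff hv).1 ⟨hx, hy⟩, Sym2.mem_iff] at hu
  rcases hu with h | h
  · exact Or.inl (flag_ext h h2)
  · exact Or.inr (flag_ext h (h2.trans h1))

theorem ends_eq {St : Setup} {x y : Flag St.ends} (hxy : x ≠ y) (h1 : x.1.2 = y.1.2) :
    St.ends x.1.2 = s(x.1.1, y.1.1) := by
  have hv : x.1.1 ≠ y.1.1 := fun h => hxy (flag_ext h h1)
  have hy := y.2
  rw [← h1] at hy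
  exact (Sym2.mem_and_mem_iff hv).1 ⟨x.2, hy⟩

theorem edgeFlags_eq {St : Setup} {x y : Flag St.ends} (hxy : x ≠ y) (h1 : x.1.2 = y.1.2) :
    Finset.univ.filter (fun fl : Flag St.ends => fl.1.2 = x.1.2) =
      @insert _ _ (@Finset.instInsert _ (Classical.decEq _)) x {y} := by
  ext u
  simp only [Finset.mem_filter, Finset.mem_univ, true_and]
  rw [@Finset.mem_insert _ (Classical.decEq _), Finset.mem_singleton]
  constructor
  · exact flag_other hxy h1
  · rintro (rfl | rfl)
    · rfl
    · exact h1.symm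

theorem edge_sum {M : Type} [AddCommMonoid M] {St : Setup} {x y : Flag St.ends} (F : Flag St.ends → M)
    (hxy : x ≠ y) (h1 : x.1.2 = y.1.2) :
    ∑ fl ∈ Finset.univ.filter (fun fl : Flag St.ends => fl.1.2 = x.1.2), F fl = F x + F y := by
  classical
  rw [edgeFlags_eq hxy h1]
  convert Finset.sum_pair hxy

theorem exponent_eq {St : Setup} {x y : Flag St.ends} (π : Flag St.ends → ℕ)
    (hxy : x ≠ y) (h1 : x.1.2 = y.1.2) : exponent St.ends π x.1.2 = π x + π y := by
  unfold exponent
  exact edge_sum π hxy h1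

end Pf
end FLL

namespace FLL
namespace Pf

/-! #### Connectivity of threads -/

def kL : (g : GK) → Fin (g.order + 1) → KFlag g
  | .openT _, k => ThreadFlag.vLeft k
  | .closedT _, k => ThreadFlag.vLeft k
  | .injuredT _ _, k => ⟨ThreadFlag.vLeft k, by simp⟩

def kR : (g : GK) → Fin (g.order + 1) → KFlag g
  | .openT _, k => ThreadFlag.vRight k
  | .closedT _, k => ThreadFlag.vRight k
  | .injuredT _ _, k => ⟨ThreadFlag.vRight k, by simp⟩

theorem kLR_edge (g : GK) (k : Fin (g.order + 1)) : kedgeOf g (kL g k) = kedgeOf g (kR g k) := by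
  cases g <;> rfl

theorem kL_eproj (g : GK) (k : Fin (g.order + 1)) : edgeProj g (kedgeOf g (kL g k)) = .e k := by
  cases g <;> rfl

theorem kR_eproj (g : GK) (k : Fin (g.order + 1)) : edgeProj g (kedgeOf g (kR g k)) = .e k := by
  cases g <;> rfl

theorem eproj_inj (g : GK) {a b : KEdge g} (h : edgeProj g a = edgeProj g b) : a = b := by
  cases g
  · exact h
  · exact h
  · exact Subtype.ext h

theorem fproj_inj (g : GK) {a b : KFlag g} (h : flagProj g a = flagProj g b) : a = b := by
  cases g
  · exact h
  · exact h
  · exact Subtype.ext h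

theorem eproj_edgeOf (g : GK) (x : KFlag g) :
    edgeProj g (kedgeOf g x) = edgeOfFlag (flagProj g x) := by
  cases g <;> rfl

theorem kRL_vert (g : GK) (k : Fin g.order) :
    kvert g (kR g k.castSucc) = kvert g (kL g k.succ) := by
  cases g <;> simp [kvert, kR, kL, tvert]

theorem kL_zero (g : GK) : kL g 0 = headFlag g := by cases g <;> rfl
theorem kR_last (g : GK) : kR g (Fin.last _) = tailFlag g := by cases g <;> rfl
theorem kL_proj (g : GK) (k) : flagProj g (kL g k) = .vLeft k := by cases g <;> rfl
theorem kR_proj (g : GK) (k) : flagProj g (kR g k) = .vRight k := by cases g <;> rfl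

theorem foot_vert (g : GK) (x : KFlag g) (k : Fin g.order) (h : flagProj g x = .vFoot k) :
    kvert g x = kvert g (kR g k.castSucc) := by
  cases g with
  | openT m => simp only [flagProj] at h; subst h; simp [kvert, kR, tvert]
  | closedT m => simp only [flagProj] at h; subst h; simp [kvert, kR, tvert]
  | injuredT m j =>
    simp only [flagProj] at h
    obtain ⟨x, hx⟩ := x
    simp only at h
    subst h; simp [kvert, kR, tvert]

theorem wfoot_partner (g : GK) (x : KFlag g) (k : Fin g.order) (h : flagProj g x = .wFoot k) :
    ∃ y : KFlag g, flagProj g y = .vFoot k := by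
  cases g with
  | openT m => exact ⟨ThreadFlag.vFoot k, rfl⟩
  | closedT m => exact ⟨ThreadFlag.vFoot k, rfl⟩
  | injuredT m j =>
    obtain ⟨x, hx⟩ := x
    simp only [flagProj] at h
    subst h
    exact ⟨⟨ThreadFlag.vFoot k, fun h => hx.2 (congrArg ThreadFlag.wFoot (ThreadFlag.vFoot.inj h)), fun h => by cases h⟩, rfl⟩

theorem vfoot_partner (g : GK) (x : KFlag g) (k : Fin g.order) (h : flagProj g x = .vFoot k) :
    ∃ y : KFlag g, flagProj g y = .wFoot k := by
  cases g with
  | openT m => exact ⟨ThreadFlag.wFoot k, rfl⟩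
  | closedT m => exact ⟨ThreadFlag.wFoot k, rfl⟩
  | injuredT m j =>
    obtain ⟨x, hx⟩ := x
    simp only [flagProj] at h
    subst h
    exact ⟨⟨ThreadFlag.wFoot k, fun h => (by cases h), fun h => hx.1 (congrArg ThreadFlag.vFoot (ThreadFlag.wFoot.inj h))⟩, rfl⟩

theorem kflag_cases (g : GK) (x : KFlag g) : (∃ k, x = kL g k) ∨ (∃ k, x = kR g k) ∨
    (∃ k, flagProj g x = .vFoot k) ∨ (∃ k, flagProj g x = .wFoot k) := by
  rcases hx : flagProj g x with k | k | k | k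
  · exact Or.inl ⟨k, fproj_inj g (by rw [hx, kL_proj])⟩
  · exact Or.inr (Or.inl ⟨k, fproj_inj g (by rw [hx, kR_proj])⟩)
  · exact Or.inr (Or.inr (Or.inl ⟨k, rfl⟩))
  · exact Or.inr (Or.inr (Or.inr ⟨k, rfl⟩))

theorem conn (g : GK) (P : KFlag g → Prop) (bad : KEdge g → Prop)
    (hbad : ∀ a, bad a → ∃ k, edgeProj g a = .f k)
    (hv : ∀ x y, kvert g x = kvert g y → (P x ↔ P y))
    (he : ∀ x y, kedgeOf g x = kedgeOf g y → ¬ bad (kedgeOf g x) → (P x ↔ P y)) (x : KFlag g) :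
    (P x ↔ P (headFlag g)) ∨ (bad (kedgeOf g x) ∧ ∃ k, flagProj g x = .wFoot k) := by
  have hLR : ∀ k, (P (kL g k) ↔ P (kR g k)) := by
    intro k
    apply he _ _ (kLR_edge g k)
    intro hb
    obtain ⟨j, hj⟩ := hbad _ hb
    rw [kL_eproj] at hj
    cases hj
  have hL : ∀ k, (P (kL g k) ↔ P (headFlag g)) := by
    intro k
    induction k using Fin.induction with
    | zero => rw [kL_zero]
    | succ i ih => rw [← ih, ← hv _ _ (kRL_vert g i), hLR]
  have hF : ∀ y k, flagProj g y = .vFoot k → (P y ↔ P (headFlag g)) := by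
    intro y k hy
    rw [hv _ _ (foot_vert g y k hy), ← hLR, hL]
  rcases kflag_cases g x with ⟨k, rfl⟩ | ⟨k, rfl⟩ | ⟨k, hk⟩ | ⟨k, hk⟩
  · exact Or.inl (hL k)
  · exact Or.inl ((hLR k).symm.trans (hL k))
  · exact Or.inl (hF _ _ hk)
  · by_cases hb : bad (kedgeOf g x)
    · exact Or.inr ⟨hb, k, hk⟩
    · left
      obtain ⟨y, hy⟩ := wfoot_partner g x k hk
      rw [he x y _ hb, hF y k hy]
      apply eproj_inj
      rw [eproj_edgeOf, eproj_edgeOf, hk, hy]; rfl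

/-- every edge of a general thread carries two distinct flags -/
theorem two_flags (g : GK) (a : KEdge g) : ∃ x y : KFlag g, x ≠ y ∧ kedgeOf g x = a ∧ kedgeOf g y = a := by
  rcases ha : edgeProj g a with k | k
  · refine ⟨kL g k, kR g k, ?_, ?_, ?_⟩
    · intro h
      have := congrArg (flagProj g) h
      rw [kL_proj, kR_proj] at this
      cases this
    · apply eproj_inj; rw [kL_eproj, ha]
    · apply eproj_inj; rw [kR_eproj, ha]
  · have : ∃ x : KFlag g, flagProj g x = .vFoot k := by
      cases g with
      | openT m => exact ⟨ThreadFlag.vFoot k, rfl⟩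
      | closedT m => exact ⟨ThreadFlag.vFoot k, rfl⟩
      | injuredT m j =>
        obtain ⟨a, h⟩ := a
        simp only [edgeProj] at ha
        subst ha
        exact ⟨⟨ThreadFlag.vFoot k, fun h' => h (congrArg ThreadEdge.f (ThreadFlag.vFoot.inj h')), fun h' => by cases h'⟩, rfl⟩
    obtain ⟨x, hx⟩ := this
    obtain ⟨y, hy⟩ := vfoot_partner g x k hx
    refine ⟨x, y, ?_, ?_, ?_⟩
    · intro h
      rw [h, hy] at hx
      cases hx
    · apply eproj_inj; rw [eproj_edgeOf, hx, ha]; rfl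
    · apply eproj_inj; rw [eproj_edgeOf, hy, ha]; rfl

/-! #### The total weight of a thread -/

def teEquiv (m : ℕ) : ThreadEdge m ≃ Fin (m+1) ⊕ Fin m where
  toFun | .e k => .inl k | .f k => .inr k
  invFun | .inl k => .e k | .inr k => .f k
  left_inv x := by cases x <;> rfl
  right_inv x := by cases x <;> rfl

instance (m : ℕ) : Fintype (ThreadEdge m) := Fintype.ofEquiv _ (teEquiv m).symm

instance instFintypeKEdge : (g : GK) → Fintype (KEdge g)
  | .openT m => inferInstanceAs (Fintype (ThreadEdge m))
  | .closedT m => inferInstanceAs (Fintype (ThreadEdge m))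
  | .injuredT m k => inferInstanceAs (Fintype {a : ThreadEdge m // a ≠ .f k})

theorem te_sum {m : ℕ} (F : ThreadEdge m → ℤ) : ∑ a, F a = ∑ k, F (.e k) + ∑ k, F (.f k) := by
  rw [← (teEquiv m).symm.sum_comp, Fintype.sum_sum_type]; rfl

theorem w2_sum (m : ℕ) : ∑ a : ThreadEdge m, ((w2 a : ℤ) - 2) = 0 := by
  simp [w2]

theorem w11_sum (m : ℕ) (hm : 1 ≤ m) : ∑ a : ThreadEdge m, ((w11 a : ℤ) - 2) = 0 := by
  rw [te_sum]
  have h1 : ∀ k : Fin (m+1), ((w11 (.e k : ThreadEdge m) : ℤ) - 2) =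
      (if k = 0 then -1 else 0) + (if k = Fin.last m then 1 else 0) := by
    intro k
    simp only [w11, Fin.ext_iff, Fin.val_zero, Fin.val_last]
    split_ifs <;> simp <;> omega
  simp only [h1, Finset.sum_add_distrib]
  simp [w11]

theorem w02_sum (m : ℕ) (hm : 1 ≤ m) : ∑ a : ThreadEdge m, ((w02 a : ℤ) - 2) = 0 := by
  obtain ⟨n, rfl⟩ : ∃ n, m = n + 1 := ⟨m - 1, by omega⟩
  rw [te_sum]
  have h1 : ∀ k : Fin (n+1+1), ((w02 (.e k : ThreadEdge (n+1)) : ℤ) - 2) =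
      (if k = 0 then -1 else 0) := by
    intro k
    simp only [w02, Fin.ext_iff, Fin.val_zero]
    split_ifs <;> simp
  have h2 : ∀ k : Fin (n+1), ((w02 (.f k : ThreadEdge (n+1)) : ℤ) - 2) =
      (if k = 0 then 1 else 0) := by
    intro k
    simp only [w02, Fin.ext_iff, Fin.val_zero]
    split_ifs <;> simp
  simp only [h1, h2]
  simp

theorem w20_sum (m : ℕ) (hm : 1 ≤ m) : ∑ a : ThreadEdge m, ((w20 a : ℤ) - 2) = 0 := by
  obtain ⟨n, rfl⟩ : ∃ n, m = n + 1 := ⟨m - 1, by omega⟩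
  rw [te_sum]
  have h1 : ∀ k : Fin (n+1+1), ((w20 (.e k : ThreadEdge (n+1)) : ℤ) - 2) =
      (if k = 0 then 1 else 0) + (if k = 1 then -2 else 0) := by
    intro k
    simp only [w20, Fin.ext_iff, Fin.val_zero, Fin.val_one]
    split_ifs <;> simp <;> omega
  have h2 : ∀ k : Fin (n+1), ((w20 (.f k : ThreadEdge (n+1)) : ℤ) - 2) =
      (if k = 0 then 1 else 0) := by
    intro k
    simp only [w20, Fin.ext_iff, Fin.val_zero]
    split_ifs <;> simp
  simp only [h1, h2, Finset.sum_add_distrib]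
  simp

theorem w11_sum_injured (m : ℕ) (j : Fin m) :
    ∑ a : KEdge (.injuredT m j), ((w11 (edgeProj (.injuredT m j) a) : ℤ) - 2) = 0 := by
  have h := w11_sum m (by have := j.2; omega)
  rw [Fintype.sum_eq_add_sum_subtype_ne _ (ThreadEdge.f j)] at h
  have h0 : ((w11 (ThreadEdge.f j) : ℕ) : ℤ) - 2 = 0 := by simp [w11]
  rw [h0, zero_add] at h
  exact h

theorem weight_sum (St : Setup) (t : St.ι) (S : Prop) :
    ∑ a : KEdge (St.kind t),
      ((clsWeight (St.cls t) S (St.kind t).order (edgeProj (St.kind t) a) : ℤ) - 2) = 0 := by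
  rcases hc : St.cls t
  · have hk := St.cls_t1 t hc
    rw [hk]; exact w11_sum_injured 1 0
  · exact Finset.sum_eq_zero (fun _ _ => rfl)
  · obtain ⟨m, _, hm, hk⟩ := St.cls_circEven t hc
    rw [hk]; exact w02_sum m hm
  · exact Finset.sum_eq_zero (fun _ _ => rfl)
  · rcases St.cls_mge1 t hc with ⟨m, hm, hk⟩ | ⟨m, j, hk⟩
    · rw [hk]; exact w11_sum m hm
    · rw [hk]; exact w11_sum_injured m j
  · obtain ⟨m, hm, hk⟩ := St.cls_dOdd t hc
    rw [hk]
    by_cases hS : S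
    · simp only [clsWeight, if_pos hS]; exact w20_sum m hm.pos
    · simp only [clsWeight, if_neg hS]; exact w02_sum m hm.pos
  · exact Finset.sum_eq_zero (fun _ _ => rfl)
  · exact Finset.sum_eq_zero (fun _ _ => rfl)

theorem eemb_bij (St : Setup) :
    Function.Bijective (fun p : Σ t : St.ι, KEdge (St.kind t) => St.eemb p.1 p.2) := by
  refine ⟨St.eemb_inj, fun e => ?_⟩
  obtain ⟨v, hv⟩ : ∃ v, v ∈ St.ends e := ⟨_, (St.ends e).out_fst_mem⟩
  obtain ⟨t, kf, h⟩ := flag_exists (St := St) ⟨(v, e), hv⟩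
  refine ⟨⟨t, kedgeOf _ kf⟩, ?_⟩
  simp only
  rw [← St.emb_edge, h]

/-- The labels of the `w`-ends of all feet are equal to `1`. -/
theorem wfoot_one {St : Setup} {S : Set St.ι} {π : Flag St.ends → ℕ} (hp : St.PiS S π)
    (t₀ : St.ι) (x₀ : KFlag (St.kind t₀)) (k₀) (hx₀ : flagProj _ x₀ = .wFoot k₀) :
    π (St.emb t₀ x₀) = 1 := by
  classical
  have hs := hp.1
  obtain ⟨y₀, hy₀⟩ := wfoot_partner _ x₀ k₀ hx₀
  have hxy₀ : x₀ ≠ y₀ := by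
    rintro rfl; rw [hx₀] at hy₀; cases hy₀
  have hke : kedgeOf _ x₀ = kedgeOf _ y₀ := by
    apply eproj_inj; rw [eproj_edgeOf, eproj_edgeOf, hx₀, hy₀]; rfl
  set f := St.eemb t₀ (kedgeOf _ x₀) with hf
  have hcut : IsCutEdge St.ends f := St.foot_cut t₀ _ ⟨k₀, by rw [eproj_edgeOf, hx₀]; rfl⟩
  have hne : St.emb t₀ x₀ ≠ St.emb t₀ y₀ := fun h => hxy₀ (St.emb_inj t₀ h)
  have hee : (St.emb t₀ x₀).1.2 = (St.emb t₀ y₀).1.2 := by rw [St.emb_edge, St.emb_edge, hke]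
  have hfx : (St.emb t₀ x₀).1.2 = f := St.emb_edge _ _
  have hends := ends_eq hne hee
  rw [hfx] at hends
  let X : St.V → Prop := fun u => ReachAvoiding St.ends {f} (St.emb t₀ x₀).1.1 u
  have hX0 : X (St.emb t₀ x₀).1.1 := Relation.ReflTransGen.refl
  have hX1 : ¬ X (St.emb t₀ y₀).1.1 := hcut _ _ hends
  have hXstep : ∀ u v e, e ≠ f → St.ends e = s(u, v) → X u → X v := by
    intro u v e hne he hu
    exact Relation.ReflTransGen.tail hu ⟨e, by simpa using hne, he⟩
  have hXedge : ∀ a b : Flag St.ends, a.1.2 = b.1.2 → a.1.2 ≠ f → (X a.1.1 ↔ X b.1.1) := by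
    intro a b hab haf
    by_cases h : a = b
    · rw [h]
    · have he := ends_eq h hab
      exact ⟨hXstep _ _ _ haf he, hXstep _ _ _ haf (by rw [he, Sym2.eq_swap])⟩
  -- constancy along the threads
  have hconst : ∀ t (x : KFlag (St.kind t)),
      (X (St.emb t x).1.1 ↔ X (St.emb t (headFlag _)).1.1) ∨
      (St.eemb t (kedgeOf _ x) = f ∧ ∃ k, flagProj _ x = .wFoot k) := by
    intro t
    refine conn (St.kind t) (fun x => X (St.emb t x).1.1) (fun a => St.eemb t a = f) ?_ ?_ ?_
    · intro a ha
      have h2 := @St.eemb_inj ⟨t, a⟩ ⟨t₀, kedgeOf _ x₀⟩ ha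
      cases h2
      exact ⟨k₀, by rw [eproj_edgeOf, hx₀]; rfl⟩
    · intro x y hxy
      simp only [(St.emb_vert t x y).1 hxy]
    · intro x y hxy hb
      apply hXedge
      · rw [St.emb_edge, St.emb_edge, hxy]
      · rw [St.emb_edge]; exact hb
  -- the contribution of each edge
  let G : Flag St.ends → ℤ := fun fl => if X fl.1.1 then (π fl : ℤ) - 1 else 0
  let H : St.E → ℤ := fun e => ∑ fl ∈ Finset.univ.filter (fun fl : Flag St.ends => fl.1.2 = e), G fl
  have hH : ∀ t (a : KEdge (St.kind t)), St.eemb t a ≠ f →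
      H (St.eemb t a) = if X (St.emb t (headFlag _)).1.1 then
        (clsWeight (St.cls t) (t ∈ S) (St.kind t).order (edgeProj (St.kind t) a) : ℤ) - 2
        else 0 := by
    intro t a ha
    obtain ⟨x, y, hxy, hx, hy⟩ := two_flags _ a
    have hne : St.emb t x ≠ St.emb t y := fun h => hxy (St.emb_inj t h)
    have hex : (St.emb t x).1.2 = St.eemb t a := by rw [St.emb_edge, hx]
    have hey : (St.emb t y).1.2 = St.eemb t a := by rw [St.emb_edge, hy]
    have h1 := edge_sum G hne (hex.trans hey.symm)
    rw [hex] at h1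
    have h2 := exponent_eq π hne (hex.trans hey.symm)
    rw [hex, hp.2 t a] at h2
    have cx : X (St.emb t x).1.1 ↔ X (St.emb t (headFlag _)).1.1 := by
      rcases hconst t x with h | h
      · exact h
      · exact absurd (hx ▸ h.1) ha
    have cy : X (St.emb t y).1.1 ↔ X (St.emb t (headFlag _)).1.1 := by
      rcases hconst t y with h | h
      · exact h
      · exact absurd (hy ▸ h.1) ha
    change ∑ fl ∈ Finset.univ.filter (fun fl : Flag St.ends => fl.1.2 = St.eemb t a), G fl = _
    rw [h1, h2]
    simp only [G, cx, cy]
    split_ifs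
    · push_cast; ring
    · rfl
  have hHf : H f = (π (St.emb t₀ x₀) : ℤ) - 1 := by
    have h1 := edge_sum G hne hee
    rw [hfx] at h1
    change ∑ fl ∈ Finset.univ.filter (fun fl : Flag St.ends => fl.1.2 = f), G fl = _
    rw [h1]
    simp only [G, if_pos hX0, if_neg hX1, add_zero]
  have hhead : ¬ X (St.emb t₀ (headFlag _)).1.1 := by
    rcases hconst t₀ y₀ with h | h
    · exact fun h' => hX1 (h.2 h')
    · obtain ⟨_, k, hk⟩ := h
      rw [hy₀] at hk; cases hk
  -- total sums
  have tot1 : ∑ fl, G fl = 0 := by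
    rw [← Finset.sum_fiberwise (s := Finset.univ) (g := fun fl : Flag St.ends => fl.1.1)]
    refine Finset.sum_eq_zero (fun v _ => ?_)
    by_cases hv : X v
    · rw [← star_sum hs v]
      refine Finset.sum_congr rfl (fun fl hfl => ?_)
      have : fl.1.1 = v := (Finset.mem_filter.1 hfl).2
      simp only [G, this, if_pos hv]
    · refine Finset.sum_eq_zero (fun fl hfl => ?_)
      have : fl.1.1 = v := (Finset.mem_filter.1 hfl).2
      simp only [G, this, if_neg hv]
  have tot2 : ∑ fl, G fl = ∑ e, H e := by
    rw [← Finset.sum_fiberwise (s := Finset.univ) (g := fun fl : Flag St.ends => fl.1.2)]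
  have tot3 : ∑ e, H e = ∑ t, ∑ a, H (St.eemb t a) := by
    rw [← (eemb_bij St).sum_comp, Fintype.sum_sigma]
  have tot4 : ∑ t, ∑ a, H (St.eemb t a) = ∑ a, H (St.eemb t₀ a) := by
    refine Finset.sum_eq_single t₀ (fun t _ ht => ?_) (by simp)
    have hnf : ∀ a, St.eemb t a ≠ f := by
      intro a ha
      have h2 := @St.eemb_inj ⟨t, a⟩ ⟨t₀, kedgeOf _ x₀⟩ ha
      exact ht (congrArg Sigma.fst h2)
    by_cases hX : X (St.emb t (headFlag _)).1.1
    · rw [← weight_sum St t (t ∈ S)]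
      refine Finset.sum_congr rfl (fun a _ => ?_)
      rw [hH t a (hnf a), if_pos hX]
    · refine Finset.sum_eq_zero (fun a _ => ?_)
      rw [hH t a (hnf a), if_neg hX]
  have tot5 : ∑ a, H (St.eemb t₀ a) = H f := by
    refine Finset.sum_eq_single (kedgeOf _ x₀) (fun a _ ha => ?_) (by simp)
    have hnf : St.eemb t₀ a ≠ f := by
      intro h
      have h2 := @St.eemb_inj ⟨t₀, a⟩ ⟨t₀, kedgeOf _ x₀⟩ h
      exact ha (by simpa using h2)
    rw [hH t₀ a hnf, if_neg hhead]
  have : (π (St.emb t₀ x₀) : ℤ) - 1 = 0 := by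
    rw [← hHf, ← tot5, ← tot4, ← tot3, ← tot2, tot1]
  omega

end Pf
end FLL

namespace FLL
namespace Pf

/-! #### Branch vertices and injured threads -/

def endFl (St : Setup) (p : St.ι × Bool) : Flag St.ends :=
  if p.2 then St.emb p.1 (tailFlag (St.kind p.1)) else St.emb p.1 (headFlag (St.kind p.1))

theorem head_ne_tail (g : GK) : headFlag g ≠ tailFlag g := by
  intro h
  have := congrArg (flagProj g) h
  rw [← kL_zero, ← kR_last, kL_proj, kR_proj] at this
  cases this

theorem endFl_inj {St : Setup} {p q : St.ι × Bool} (h : endFl St p = endFl St q) : p = q := by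
  obtain ⟨t, b⟩ := p
  obtain ⟨t', b'⟩ := q
  have ht : t = t' := by
    unfold endFl at h
    split_ifs at h <;> exact emb_thread_unique h
  subst ht
  have h1 := head_ne_tail (St.kind t)
  cases b <;> cases b' <;> simp [endFl] at h ⊢
  · exact h1 (St.emb_inj _ h)
  · exact h1 (St.emb_inj _ h).symm

theorem endFl_vert {St : Setup} (p : St.ι × Bool) :
    (endFl St p).1.1 = if p.2 then St.tailV p.1 else St.headV p.1 := by
  unfold endFl Setup.tailV Setup.headV
  split_ifs <;> rfl

theorem branch_flags {St : Setup} (hM : St.MatchingHyps) {π : Flag St.ends → ℕ}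
    (hs : IsStarLabelling St.ends π) {fl : Flag St.ends} (hv : fl.1.1 ∈ St.branchV) :
    ∃ t, St.isEdgeThread t ∧
      (fl = St.emb t (headFlag _) ∨ fl = St.emb t (tailFlag _)) := by
  have h1 := hM.2.1 _ hv
  have h2 := hM.2.2.1 _ hv
  unfold Setup.endCount at h1 h2
  obtain ⟨p, hp⟩ := Set.ncard_eq_one.1 h1
  obtain ⟨q, r, hqr, hq⟩ := Set.ncard_eq_two.1 h2
  have mp : p ∈ ({p} : Set (St.ι × Bool)) := rfl
  have mq : q ∈ ({q, r} : Set (St.ι × Bool)) := Or.inl rfl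
  have mr : r ∈ ({q, r} : Set (St.ι × Bool)) := Or.inr rfl
  rw [← hp] at mp
  rw [← hq] at mq mr
  simp only [Set.mem_ofPred_eq] at mp mq mr
  rw [← endFl_vert] at mp mq mr
  have d : ∀ t, St.inM t → St.inD t → False := by
    intro t a b
    unfold Setup.inM at a
    unfold Setup.inD at b
    rcases a with a | a <;> rcases b with b | b | b <;> rw [a] at b <;> cases b
  have hpq : p ≠ q := by rintro rfl; exact d _ mp.1 mq.1
  have hpr : p ≠ r := by rintro rfl; exact d _ mp.1 mr.1
  have key := star_three hs (x := endFl St p) (y := endFl St q) (z := endFl St r) (u := fl)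
    (fun h => hpq (endFl_inj h)) (fun h => hpr (endFl_inj h)) (fun h => hqr (endFl_inj h))
    (mp.2.trans mq.2.symm) (mp.2.trans mr.2.symm) mp.2.symm
  have eM : ∀ t, St.inM t → St.isEdgeThread t := by
    intro t a; unfold Setup.inM at a; unfold Setup.isEdgeThread; tauto
  have eD : ∀ t, St.inD t → St.isEdgeThread t := by
    intro t a; unfold Setup.inD at a; unfold Setup.isEdgeThread; tauto
  have fin : ∀ p : St.ι × Bool, St.isEdgeThread p.1 → fl = endFl St p → ∃ t, St.isEdgeThread t ∧
      (fl = St.emb t (headFlag _) ∨ fl = St.emb t (tailFlag _)) := by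
    intro p hp h
    refine ⟨p.1, hp, ?_⟩
    unfold endFl at h
    split_ifs at h
    · exact Or.inr h
    · exact Or.inl h
  rcases key with h | h | h
  · exact fin p (eM _ mp.1) h
  · exact fin q (eD _ mq.1) h
  · exact fin r (eD _ mr.1) h

theorem branch_head {St : Setup} {t : St.ι} (h : St.isEdgeThread t) :
    (St.emb t (headFlag _)).1.1 ∈ St.branchV := ⟨t, h, Or.inl rfl⟩

theorem branch_tail {St : Setup} {t : St.ι} (h : St.isEdgeThread t) :
    (St.emb t (tailFlag _)).1.1 ∈ St.branchV := ⟨t, h, Or.inr rfl⟩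

theorem partner (g : GK) (x : KFlag g) : (∃ y, y ≠ x ∧ kvert g y = kvert g x) ∨
    (∃ k, flagProj g x = .wFoot k) ∨
    ((∀ m, g ≠ .closedT m) ∧ (x = headFlag g ∨ x = tailFlag g)) := by
  have hcl : (∀ m, g ≠ .closedT m) ∨ kvert g (headFlag g) = kvert g (tailFlag g) := by
    cases g with
    | openT m => left; intro _ h; cases h
    | closedT m => right; simp [kvert, headFlag, tailFlag, tvert]
    | injuredT m k => left; intro _ h; cases h
  have hLR : ∀ i j, kL g i ≠ kR g j := by
    intro i j h
    have := congrArg (flagProj g) h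
    rw [kL_proj, kR_proj] at this
    cases this
  rcases kflag_cases g x with ⟨k, rfl⟩ | ⟨k, rfl⟩ | ⟨k, hk⟩ | ⟨k, hk⟩
  · induction k using Fin.cases with
    | zero =>
      rw [kL_zero]
      rcases hcl with h | h
      · exact Or.inr (Or.inr ⟨h, Or.inl rfl⟩)
      · exact Or.inl ⟨_, (head_ne_tail g).symm, h.symm⟩
    | succ j => exact Or.inl ⟨kR g j.castSucc, (hLR _ _).symm, kRL_vert g j⟩
  · induction k using Fin.lastCases with
    | last =>
      rw [kR_last]
      rcases hcl with h | h
      · exact Or.inr (Or.inr ⟨h, Or.inr rfl⟩)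
      · exact Or.inl ⟨_, (head_ne_tail g), h⟩
    | cast j => exact Or.inl ⟨kL g j.succ, hLR _ _, (kRL_vert g j).symm⟩
  · refine Or.inl ⟨kR g k.castSucc, ?_, (foot_vert g x k hk).symm⟩
    intro h
    rw [← h, kR_proj] at hk
    cases hk
  · exact Or.inr (Or.inl ⟨k, hk⟩)

theorem four_flags {St : Setup} {π : Flag St.ends → ℕ} (hs : IsStarLabelling St.ends π)
    {t t' : St.ι} (htt : t ≠ t') {x y : KFlag (St.kind t)} {x' y' : KFlag (St.kind t')}
    (hxy : x ≠ y) (hxy' : x' ≠ y') (h1 : (St.emb t x).1.1 = (St.emb t y).1.1)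
    (h2 : (St.emb t' x').1.1 = (St.emb t' y').1.1)
    (h3 : (St.emb t x).1.1 = (St.emb t' x').1.1) : False := by
  have n1 : St.emb t x ≠ St.emb t y := fun h => hxy (St.emb_inj _ h)
  have n2 : St.emb t x ≠ St.emb t' x' := fun h => htt (emb_thread_unique h)
  have n3 : St.emb t y ≠ St.emb t' x' := fun h => htt (emb_thread_unique h)
  rcases star_three hs n1 n2 n3 h1 h3 (u := St.emb t' y') (h2.symm.trans h3.symm) with h | h | h
  · exact htt (emb_thread_unique h).symm
  · exact htt (emb_thread_unique h).symm
  · exact hxy' (St.emb_inj _ h).symm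

def iR (m : ℕ) (k : Fin m) : KFlag (.injuredT m k) := ⟨.vRight k.castSucc, by simp⟩
def iL (m : ℕ) (k : Fin m) : KFlag (.injuredT m k) := ⟨.vLeft k.succ, by simp⟩

theorem iRL_vert (m : ℕ) (k : Fin m) : kvert _ (iR m k) = kvert _ (iL m k) := by
  simp [kvert, iR, iL, tvert]

theorem iR_ne_iL (m : ℕ) (k : Fin m) : iR m k ≠ iL m k := by
  intro h
  have := congrArg (flagProj _) h
  cases this

theorem injured_unique (m : ℕ) (k : Fin m) (x : KFlag (.injuredT m k))
    (h : kvert _ x = kvert _ (iR m k)) : x = iR m k ∨ x = iL m k := by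
  obtain ⟨x, hx⟩ := x
  cases x with
  | vLeft j =>
    right
    simp only [kvert, tvert, iR, Sum.inl.injEq] at h
    apply Subtype.ext
    simp only [iL]
    congr 1
    apply Fin.ext
    simpa using h
  | vRight j =>
    left
    simp only [kvert, tvert, iR, Sum.inl.injEq] at h
    apply Subtype.ext
    simp only [iR]
    congr 1
    apply Fin.ext
    simpa using h
  | vFoot j =>
    exfalso
    simp only [kvert, tvert, iR, Sum.inl.injEq] at h
    apply hx.1
    congr 1
    apply Fin.ext
    simpa using h
  | wFoot j => simp [kvert, tvert, iR] at h

/-- `fl` is the third flag at the injured vertex of the injured thread `t` -/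
def Third (St : Setup) (t : St.ι) (fl : Flag St.ends) : Prop :=
  ∃ (m : ℕ) (k : Fin m) (h : St.kind t = .injuredT m k),
    fl.1.1 = (embG h (iR m k)).1.1 ∧ fl ≠ embG h (iR m k) ∧ fl ≠ embG h (iL m k)

theorem third_cases {St : Setup} (hM : St.MatchingHyps) {S : Set St.ι} {π : Flag St.ends → ℕ}
    (hp : St.PiS S π) {t : St.ι} {fl : Flag St.ends} (h3 : Third St t fl) :
    π fl = 1 ∨ ∃ s, St.cls s = .t1 ∧ (fl = St.emb s (headFlag _) ∨ fl = St.emb s (tailFlag _)) := by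
  have hs := hp.1
  obtain ⟨m, k, h, hv, hr, hl⟩ := h3
  have hv' := (embG_vert h (iR m k) (iL m k)).1 (iRL_vert m k)
  obtain ⟨s, x, rfl⟩ := flag_exists fl
  have hst : t ≠ s := by
    rintro rfl
    obtain ⟨y, hy⟩ := emb_exists h x
    rw [hy] at hv hr hl
    rcases injured_unique m k y ((embG_vert h _ _).2 hv) with rfl | rfl
    · exact hr rfl
    · exact hl rfl
  rcases partner _ x with ⟨y, hy, hxy⟩ | ⟨j, hj⟩ | ⟨hc, hx⟩
  · exfalso
    have e1 := (St.emb_vert s y x).1 hxy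
    refine four_flags hs hst (x := cast (congrArg KFlag h.symm) (iR m k))
      (y := cast (congrArg KFlag h.symm) (iL m k)) (x' := x) (y' := y) ?_ hy.symm hv' e1.symm hv.symm
    intro e
    exact iR_ne_iL m k (embG_inj h (congrArg (St.emb t) e))
  · exact Or.inl (wfoot_one hp s x j hj)
  · by_cases hcl : St.cls s = .t1
    · refine Or.inr ⟨s, hcl, ?_⟩
      rcases hx with rfl | rfl
      · exact Or.inl rfl
      · exact Or.inr rfl
    · exfalso
      have he : St.isEdgeThread s := by
        unfold Setup.isEdgeThread
        rcases hcs : St.cls s <;> simp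
        · exact hcl hcs
        · obtain ⟨m, _, hk⟩ := St.cls_circOdd s hcs
          exact hc m hk
        · obtain ⟨m, _, _, hk⟩ := St.cls_circEven s hcs
          exact hc m hk
      have hb : (St.emb s x).1.1 ∈ St.branchV := by
        rcases hx with rfl | rfl
        · exact branch_head he
        · exact branch_tail he
      rw [hv] at hb
      obtain ⟨t', _, ht'⟩ := branch_flags hM hs hb
      have hb2 := hb
      rw [hv'] at hb2
      have htt : t = t' := by
        rcases ht' with h' | h'
        · exact emb_thread_unique h'
        · exact emb_thread_unique h'
      subst htt
      rw [← embG_head h, ← embG_tail h] at ht'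
      obtain ⟨t2, _, ht2⟩ := branch_flags hM hs hb2
      have htt : t = t2 := by
        rcases ht2 with h' | h'
        · exact emb_thread_unique h'
        · exact emb_thread_unique h'
      subst htt
      rw [← embG_head h, ← embG_tail h] at ht2
      have hk := k.2
      rcases ht' with h' | h'
      · have := congrArg (flagProj _) (embG_inj h h')
        cases this
      · have := congrArg (flagProj _) (embG_inj h h')
        have h4 : k.castSucc = Fin.last m := ThreadFlag.vRight.inj this
        have h5 := congrArg Fin.val h4
        rw [Fin.val_castSucc, Fin.val_last] at h5
        omega

theorem third_exists {St : Setup} {π : Flag St.ends → ℕ} (hs : IsStarLabelling St.ends π)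
    {t : St.ι} {m : ℕ} {k : Fin m} (h : St.kind t = .injuredT m k) :
    ∃ fl, Third St t fl := by
  have hv' := (embG_vert h (iR m k) (iL m k)).1 (iRL_vert m k)
  obtain ⟨j, hj, h1, h2⟩ : ∃ j, j < 3 ∧ j ≠ π (embG h (iR m k)) ∧ j ≠ π (embG h (iL m k)) := by
    by_contra hcon
    push Not at hcon
    have a := hcon 0 (by omega)
    have b := hcon 1 (by omega)
    have c := hcon 2 (by omega)
    omega
  obtain ⟨fl, hfl, hπ⟩ := star_surj hs (embG h (iR m k)).1.1 j hj
  refine ⟨fl, m, k, h, hfl, ?_, ?_⟩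
  · rintro rfl; exact h1 hπ.symm
  · rintro rfl; exact h2 hπ.symm

/-- label data at the injured vertex -/
theorem third_labels {St : Setup} {π : Flag St.ends → ℕ} (hs : IsStarLabelling St.ends π)
    {t : St.ι} {m : ℕ} {k : Fin m} (h : St.kind t = .injuredT m k) {fl : Flag St.ends}
    (h3 : Third St t fl) : π fl ≠ π (embG h (iR m k)) ∧ π fl ≠ π (embG h (iL m k)) ∧
      π (embG h (iR m k)) ≠ π (embG h (iL m k)) := by
  obtain ⟨m', k', h', hv, hr, hl⟩ := h3
  have e := h.symm.trans h'
  cases e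
  have hv' := (embG_vert h (iR m k) (iL m k)).1 (iRL_vert m k)
  exact ⟨fun e => hr (star_inj hs hv e), fun e => hl (star_inj hs (hv.trans hv') e),
    fun e => iR_ne_iL m k (embG_inj h (star_inj hs hv' e))⟩

theorem third_vert_unique {St : Setup} {π : Flag St.ends → ℕ} (hs : IsStarLabelling St.ends π)
    {t t' : St.ι} {fl : Flag St.ends} (h3 : Third St t fl) (h3' : Third St t' fl) : t = t' := by
  by_contra hne
  obtain ⟨m, k, h, hv, hr, hl⟩ := h3
  obtain ⟨m', k', h', hv', hr', hl'⟩ := h3'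
  refine four_flags hs hne (x := cast (congrArg KFlag h.symm) (iR m k))
      (y := cast (congrArg KFlag h.symm) (iL m k)) (x' := cast (congrArg KFlag h'.symm) (iR m' k'))
      (y' := cast (congrArg KFlag h'.symm) (iL m' k')) ?_ ?_ ?_ ?_ ?_
  · intro e
    exact iR_ne_iL m k (embG_inj h (congrArg (St.emb t) e))
  · intro e
    exact iR_ne_iL m' k' (embG_inj h' (congrArg (St.emb t') e))
  · exact (embG_vert h (iR m k) (iL m k)).1 (iRL_vert m k)
  · exact (embG_vert h' (iR m' k') (iL m' k')).1 (iRL_vert m' k')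
  · exact hv.symm.trans hv'

theorem exp_G {St : Setup} {t : St.ι} {g : GK} (h : St.kind t = g) (π : Flag St.ends → ℕ)
    {x y : KFlag g} (hxy : x ≠ y) (he : kedgeOf g x = kedgeOf g y) :
    exponent St.ends π (eembG h (kedgeOf g x)) = π (embG h x) + π (embG h y) := by
  rw [← embG_edge]
  refine exponent_eq π (fun e => hxy (embG_inj h e)) ?_
  rw [embG_edge, embG_edge, he]

theorem kL_ne_kR (g : GK) (i j) : kL g i ≠ kR g j := by
  intro h
  have := congrArg (flagProj g) h
  rw [kL_proj, kR_proj] at this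
  cases this

/-- weights of the path edges -/
theorem path_weight {St : Setup} {S : Set St.ι} {π : Flag St.ends → ℕ} (hp : St.PiS S π)
    {t : St.ι} {g : GK} (h : St.kind t = g) (k : Fin (g.order + 1)) :
    π (embG h (kL g k)) + π (embG h (kR g k)) = clsWeight (St.cls t) (t ∈ S) g.order (.e k) := by
  rw [← exp_G h π (kL_ne_kR g k k) (kLR_edge g k), piS_G h hp, kL_eproj]

theorem t1_labels {St : Setup} {S : Set St.ι} {π : Flag St.ends → ℕ} (hp : St.PiS S π)
    {s : St.ι} (hc : St.cls s = .t1) {u : Flag St.ends} (h3 : Third St s u) :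
    (π u = 1 → π (St.emb s (headFlag _)) = 1 ∧ π (St.emb s (tailFlag _)) = 1) ∧
    (π (St.emb s (headFlag _)) = 1 ∨ π (St.emb s (tailFlag _)) = 1) := by
  have hk := St.cls_t1 s hc
  have hs := hp.1
  have w0 := path_weight hp hk 0
  have w1 := path_weight hp hk (Fin.last 1)
  rw [hc] at w0 w1
  have e0 : clsWeight TClass.t1 (s ∈ S) 1 (.e 0) = 1 := by simp [clsWeight, w11]
  have e1 : clsWeight TClass.t1 (s ∈ S) 1 (.e (Fin.last 1)) = 3 := by simp [clsWeight, w11]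
  obtain ⟨d1, d2, d3⟩ := third_labels hs hk h3
  rw [← embG_head hk, ← embG_tail hk]
  have w0' : π (embG hk (headFlag _)) + π (embG hk (iR 1 0)) = 1 := w0.trans e0
  have w1' : π (embG hk (iL 1 0)) + π (embG hk (tailFlag _)) = 3 := w1.trans e1
  have l1 := star_le hs (embG hk (iR 1 0))
  have l2 := star_le hs (embG hk (iL 1 0))
  have l3 := star_le hs (embG hk (headFlag _))
  have l4 := star_le hs (embG hk (tailFlag _))
  have l5 := star_le hs u
  constructor
  · intro h; constructor <;> omega
  · omega

theorem mge1_third {St : Setup} (hM : St.MatchingHyps) {S : Set St.ι} {π : Flag St.ends → ℕ}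
    (hp : St.PiS S π) {t : St.ι} (hc : St.cls t = .mge1) {fl : Flag St.ends}
    (h3 : Third St t fl) : π fl = 1 := by
  by_contra hne
  have hs := hp.1
  let B : Set St.ι := {t | ∃ fl, Third St t fl ∧ π fl ≠ 1}
  have step : ∀ t : B, ∃ s : B, St.cls s = .t1 ∧ ∃ fl, Third St t fl ∧ π fl ≠ 1 ∧
      (fl = St.emb s (headFlag _) ∨ fl = St.emb s (tailFlag _)) := by
    rintro ⟨t, fl, h3, h1⟩
    rcases third_cases hM hp h3 with h | ⟨s, hcs, hfl⟩
    · exact absurd h h1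
    · obtain ⟨u, hu⟩ := third_exists hs (St.cls_t1 s hcs)
      refine ⟨⟨s, u, hu, ?_⟩, hcs, fl, h3, h1, hfl⟩
      intro hu1
      obtain ⟨a, b⟩ := (t1_labels hp hcs hu).1 hu1
      rcases hfl with rfl | rfl
      · exact h1 a
      · exact h1 b
  choose φ hφ using step
  have hinj : Function.Injective φ := by
    intro a b hab
    obtain ⟨hca, fa, ha3, ha1, ha⟩ := hφ a
    obtain ⟨hcb, fb, hb3, hb1, hb⟩ := hφ b
    rw [← hab] at hb
    obtain ⟨u, hu⟩ := third_exists hs (St.cls_t1 _ hca)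
    have hor := (t1_labels hp hca hu).2
    have : fa = fb := by
      rcases ha with ha | ha <;> rcases hb with hb | hb
      · rw [ha, hb]
      · rw [ha] at ha1; rw [hb] at hb1; exact absurd hor (by tauto)
      · rw [ha] at ha1; rw [hb] at hb1; exact absurd hor (by tauto)
      · rw [ha, hb]
    subst this
    exact Subtype.ext (third_vert_unique hs ha3 hb3)
  have hsurj := Finite.surjective_of_injective hinj
  obtain ⟨t', ht'⟩ := hsurj ⟨t, fl, h3, hne⟩
  have := (hφ t').1
  rw [ht'] at this
  simp only at this
  rw [hc] at this
  cases this

end Pf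
end FLL

namespace FLL
namespace Pf

/-! #### Classification of the labellings of threads -/

theorem num11 (m : ℕ) (hm : 1 ≤ m) (a b p : ℕ → ℕ)
    (he : ∀ i ≤ m, a i + b i = if i = 0 then 1 else if i = m then 3 else 2)
    (hv : ∀ i < m, b i ≠ a (i+1) ∧ b i ≠ p i ∧ a (i+1) ≠ p i)
    (hle : ∀ i ≤ m, a i ≤ 2 ∧ b i ≤ 2) (hp : ∀ i < m, p i = 1) : a 0 = 1 ∧ b m = 1 := by
  have hb : ∀ i < m, b i = 0 := by
    intro i
    induction i with
    | zero =>
      intro h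
      have := he 0 (by omega)
      have := hv 0 h
      have := hp 0 h
      simp at *
      omega
    | succ n ih =>
      intro h
      have h1 := he (n+1) (by omega)
      have h2 := hv n (by omega)
      have h3 := hp n (by omega)
      have h4 := ih (by omega)
      have h5 := hle (n+1) (by omega)
      rw [if_neg (by omega), if_neg (by omega)] at h1
      omega
  obtain ⟨n, rfl⟩ : ∃ n, m = n + 1 := ⟨m - 1, by omega⟩
  have g0 := hb 0 (by omega)
  have e0 := he 0 (by omega)
  have g1 := hb n (by omega)
  have e1 := he (n+1) (by omega)
  have h2 := hv n (by omega)
  have h3 := hp n (by omega)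
  have h5 := hle (n+1) (by omega)
  simp at e0 e1
  omega

theorem num02 (m : ℕ) (hm : 1 ≤ m) (a b p : ℕ → ℕ)
    (he : ∀ i ≤ m, a i + b i = if i = 0 then 1 else 2)
    (hv : ∀ i < m, b i ≠ a (i+1) ∧ b i ≠ p i ∧ a (i+1) ≠ p i)
    (hle : ∀ i ≤ m, a i ≤ 2 ∧ b i ≤ 2) (hp : ∀ i < m, p i = if i = 0 then 2 else 1) :
    (a 0 = 1 ∧ b m = 1) ∨ (∀ i ≤ m, a i = 0 ∧ b i = if i = 0 then 1 else 2) := by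
  have e0 := he 0 (by omega)
  have v0 := hv 0 (by omega)
  have p0 := hp 0 (by omega)
  have e1 := he 1 (by omega)
  have l1 := hle 1 (by omega)
  simp at e0 v0 p0 e1
  by_cases hb : b 0 = 1
  · right
    intro i
    induction i with
    | zero => intro _; simp; omega
    | succ n ih =>
      intro h
      have h1 := he (n+1) (by omega)
      have h2 := hv n (by omega)
      have h3 := hp n (by omega)
      have h4 := ih (by omega)
      have h5 := hle (n+1) (by omega)
      rw [if_neg (by omega)] at h1 ⊢
      split_ifs at h3 h4 <;> omega
  · left
    by_cases h1 : m = 1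
    · subst h1; omega
    · exfalso
      have v1 := hv 1 (by omega)
      have p1 := hp 1 (by omega)
      simp at p1
      omega

theorem num20 (m : ℕ) (hm : 1 ≤ m) (a b p : ℕ → ℕ)
    (he : ∀ i ≤ m, a i + b i = if i = 0 then 3 else if i = 1 then 0 else 2)
    (hv : ∀ i < m, b i ≠ a (i+1) ∧ b i ≠ p i ∧ a (i+1) ≠ p i)
    (hle : ∀ i ≤ m, a i ≤ 2 ∧ b i ≤ 2) (hp : ∀ i < m, p i = if i = 0 then 2 else 1) :
    ∀ i ≤ m, (a i = if i = 1 then 0 else 2) ∧ b i = if i = 0 then 1 else 0 := by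
  have e0 := he 0 (by omega)
  have v0 := hv 0 (by omega)
  have p0 := hp 0 (by omega)
  have e1 := he 1 (by omega)
  have l0 := hle 0 (by omega)
  simp at e0 v0 p0 e1
  intro i
  induction i with
  | zero => intro _; simp; omega
  | succ n ih =>
    intro h
    by_cases hn : n = 0
    · subst hn; simp; omega
    have h1 := he (n+1) (by omega)
    have h2 := hv n (by omega)
    have h3 := hp n (by omega)
    have h4 := ih (by omega)
    have h5 := hle (n+1) (by omega)
    rw [if_neg (by omega), if_neg (by omega)] at h1
    rw [if_neg (by omega), if_neg (by omega)]
    rw [if_neg hn] at h3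
    have h6 := h4.2
    rw [if_neg hn] at h6
    omega

theorem num2 (m : ℕ) (a b p : ℕ → ℕ)
    (he : ∀ i ≤ m, a i + b i = 2)
    (hv : ∀ i < m, b i ≠ a (i+1) ∧ b i ≠ p i ∧ a (i+1) ≠ p i)
    (hle : ∀ i ≤ m, a i ≤ 2 ∧ b i ≤ 2) (hp : ∀ i < m, p i = 1) :
    (a 0 = 1 ∧ b m = 1) ∨ (∀ i ≤ m, a i = 2 ∧ b i = 0) ∨ (∀ i ≤ m, a i = 0 ∧ b i = 2) := by
  have e0 := he 0 (by omega)
  have l0 := hle 0 (by omega)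
  have step : ∀ n < m, (a n = 2 → b n = 0 → a (n+1) = 2 ∧ b (n+1) = 0) ∧
      (a n = 0 → b n = 2 → a (n+1) = 0 ∧ b (n+1) = 2) := by
    intro n h
    have h1 := he (n+1) (by omega)
    have h2 := hv n (by omega)
    have h3 := hp n (by omega)
    have h5 := hle (n+1) (by omega)
    omega
  by_cases ha : a 0 = 2
  · right; left
    intro i
    induction i with
    | zero => intro _; omega
    | succ n ih =>
      intro h
      have h4 := ih (by omega)
      exact (step n (by omega)).1 h4.1 h4.2
  by_cases ha' : a 0 = 0
  · right; right
    intro i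
    induction i with
    | zero => intro _; omega
    | succ n ih =>
      intro h
      have h4 := ih (by omega)
      exact (step n (by omega)).2 h4.1 h4.2
  · left
    by_cases hm : m = 0
    · subst hm; omega
    · have := hv 0 (by omega)
      have := hp 0 (by omega)
      omega

/-- flags of an open thread -/
def oe {St : Setup} {t : St.ι} {m : ℕ} (h : St.kind t = .openT m) (x : ThreadFlag m) :
    Flag St.ends := embG (g := .openT m) h x

section openthreads
variable {St : Setup} {S : Set St.ι} {π : Flag St.ends → ℕ} {t : St.ι} {m : ℕ}

theorem oe_inj (h : St.kind t = .openT m) {x y : ThreadFlag m} (e : oe h x = oe h y) : x = y :=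
  embG_inj (g := .openT m) h e

theorem oe_vert (h : St.kind t = .openT m) (x y : ThreadFlag m) :
    tvert x = tvert y ↔ (oe h x).1.1 = (oe h y).1.1 :=
  embG_vert (g := .openT m) h x y

theorem oe_head (h : St.kind t = .openT m) :
    oe h (.vLeft 0) = St.emb t (headFlag _) := embG_head h

theorem oe_tail (h : St.kind t = .openT m) :
    oe h (.vRight (Fin.last m)) = St.emb t (tailFlag _) := embG_tail h

theorem oe_exists (h : St.kind t = .openT m) (kf : KFlag (St.kind t)) :
    ∃ x, St.emb t kf = oe h x := emb_exists h kf

theorem oe_wfoot (hp : St.PiS S π) (h : St.kind t = .openT m) (k : Fin m) :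
    π (oe h (.wFoot k)) = 1 := by
  have : ∀ (g : GK) (h : St.kind t = g) (x : KFlag g) (k), flagProj g x = .wFoot k →
      π (embG h x) = 1 := by
    intro g h x k hx
    subst h
    exact wfoot_one hp t x k hx
  exact this _ h (ThreadFlag.wFoot k) k rfl

theorem oe_path_weight (hp : St.PiS S π) (h : St.kind t = .openT m) (k : Fin (m+1)) :
    π (oe h (.vLeft k)) + π (oe h (.vRight k)) = clsWeight (St.cls t) (t ∈ S) m (.e k) :=
  path_weight hp h k

theorem oe_foot_weight (hp : St.PiS S π) (h : St.kind t = .openT m) (k : Fin m) :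
    π (oe h (.vFoot k)) + 1 = clsWeight (St.cls t) (t ∈ S) m (.f k) := by
  have h1 := exp_G (g := .openT m) h π (x := ThreadFlag.vFoot k) (y := ThreadFlag.wFoot k)
    (by intro e; cases e) rfl
  have h2 := piS_G (g := .openT m) h hp (ThreadEdge.f k)
  have h3 := oe_wfoot hp h k
  rw [← h3]
  exact h1.symm.trans h2

theorem oe_tri (hs : IsStarLabelling St.ends π) (h : St.kind t = .openT m) (k : Fin m) :
    π (oe h (.vRight k.castSucc)) ≠ π (oe h (.vLeft k.succ)) ∧
    π (oe h (.vRight k.castSucc)) ≠ π (oe h (.vFoot k)) ∧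
    π (oe h (.vLeft k.succ)) ≠ π (oe h (.vFoot k)) := by
  refine ⟨fun e => ?_, fun e => ?_, fun e => ?_⟩
  · have := oe_inj h (star_inj hs ((oe_vert h _ _).1 (by simp [tvert])) e)
    cases this
  · have := oe_inj h (star_inj hs ((oe_vert h _ _).1 (by simp [tvert])) e)
    cases this
  · have := oe_inj h (star_inj hs ((oe_vert h _ _).1 (by simp [tvert])) e)
    cases this

theorem oe_tri_all (hs : IsStarLabelling St.ends π) (h : St.kind t = .openT m) (k : Fin m)
    (u : Flag St.ends) (hu : u.1.1 = (oe h (.vRight k.castSucc)).1.1) :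
    u = oe h (.vRight k.castSucc) ∨ u = oe h (.vLeft k.succ) ∨ u = oe h (.vFoot k) := by
  refine star_three hs ?_ ?_ ?_ ((oe_vert h _ _).1 (by simp [tvert]))
    ((oe_vert h _ _).1 (by simp [tvert])) hu
  · intro e; cases oe_inj h e
  · intro e; cases oe_inj h e
  · intro e; cases oe_inj h e

/-- the labels of an open thread as functions of natural numbers -/
theorem oe_nat (hp : St.PiS S π) (h : St.kind t = .openT m) : ∃ a b p : ℕ → ℕ,
    (∀ k : Fin (m+1), π (oe h (.vLeft k)) = a k) ∧ (∀ k : Fin (m+1), π (oe h (.vRight k)) = b k) ∧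
    (∀ k : Fin m, π (oe h (.vFoot k)) = p k) ∧
    (∀ i < m, b i ≠ a (i+1) ∧ b i ≠ p i ∧ a (i+1) ≠ p i) ∧
    (∀ i ≤ m, a i ≤ 2 ∧ b i ≤ 2) ∧
    (∀ k : Fin (m+1), a k + b k = clsWeight (St.cls t) (t ∈ S) m (.e k)) ∧
    (∀ k : Fin m, p k + 1 = clsWeight (St.cls t) (t ∈ S) m (.f k)) := by
  refine ⟨fun i => if hi : i < m + 1 then π (oe h (.vLeft ⟨i, hi⟩)) else 0,
    fun i => if hi : i < m + 1 then π (oe h (.vRight ⟨i, hi⟩)) else 0,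
    fun i => if hi : i < m then π (oe h (.vFoot ⟨i, hi⟩)) else 0, ?_, ?_, ?_, ?_, ?_, ?_, ?_⟩
  · intro k; simp only [dif_pos k.2]
  · intro k; simp only [dif_pos k.2]
  · intro k; simp
  · intro i hi
    simp only [dif_pos hi, dif_pos (show i < m + 1 by omega), dif_pos (show i + 1 < m + 1 by omega)]
    exact oe_tri hp.1 h ⟨i, hi⟩
  · intro i hi
    simp only [dif_pos (show i < m + 1 by omega)]
    exact ⟨star_le hp.1 _, star_le hp.1 _⟩
  · intro k
    simp only [dif_pos k.2]
    exact oe_path_weight hp h k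
  · intro k
    simp only [dif_pos k.2]
    exact oe_foot_weight hp h k

end openthreads

/-- `L` is one of the labellings of a thread of class `c` that are not of type `(1,1)`. -/
def DRel (c : TClass) (m : ℕ) (inS : Prop) (L : ThreadFlag m → ℕ) : Prop :=
  (c = .dOdd ∧ Odd m ∧ ((inS ∧ ∀ x, L x = (pi20 x : ℕ)) ∨ (¬ inS ∧ ∀ x, L x = (pi02 x : ℕ)))) ∨
  (((c = .m0 ∧ m = 0) ∨ (c = .d0 ∧ m = 0) ∨ c = .dEven) ∧ Even m ∧
    ((∀ x, L x = (rho20 x : ℕ)) ∨ (∀ x, L x = (rho02 x : ℕ))))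

theorem mge1_type {St : Setup} (hM : St.MatchingHyps) {S : Set St.ι} {π : Flag St.ends → ℕ}
    (hp : St.PiS S π) {t : St.ι} (hc : St.cls t = .mge1) :
    π (St.emb t (headFlag _)) = 1 ∧ π (St.emb t (tailFlag _)) = 1 := by
  have hs := hp.1
  rcases St.cls_mge1 t hc with ⟨m, hm, h⟩ | ⟨m, j, h⟩
  · obtain ⟨a, b, p, ha, hb, hpp, hv, hle, he, hf⟩ := oe_nat hp h
    rw [hc] at he hf
    have := num11 m hm a b p ?_ hv hle ?_
    · rw [← oe_head h, ← oe_tail h, ha, hb]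
      simpa using this
    · intro i hi
      exact he ⟨i, by omega⟩
    · intro i hi
      have := hf ⟨i, hi⟩
      simpa [clsWeight, w11] using this
  · obtain ⟨fl, h3⟩ := third_exists hs h
    have h1 := mge1_third hM hp hc h3
    obtain ⟨d1, d2, d3⟩ := third_labels hs h h3
    rw [h1] at d1 d2
    rw [← embG_head h, ← embG_tail h]
    have hw := fun k => path_weight hp h k
    rw [hc] at hw
    have hj := j.2
    let F : Fin (m+1) → KFlag (.injuredT m j) := fun k => ⟨.vLeft k, by simp⟩
    let G : Fin (m+1) → KFlag (.injuredT m j) := fun k => ⟨.vRight k, by simp⟩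
    let Q : ∀ k : Fin m, k ≠ j → KFlag (.injuredT m j) := fun k hk =>
      ⟨.vFoot k, by simp [hk]⟩
    have foot1 : ∀ k hk, π (embG h (Q k hk)) = 1 := by
      intro k hk
      let Q' : KFlag (.injuredT m j) := ⟨.wFoot k, by simp [hk]⟩
      have e1 := exp_G (g := .injuredT m j) h π (x := Q k hk) (y := Q')
        (by intro e; cases congrArg (flagProj _) e) rfl
      have e2 := piS_G h hp (kedgeOf _ (Q k hk))
      have e3 : π (embG h Q') = 1 := by
        have : ∀ (g : GK) (h : St.kind t = g) (x : KFlag g) (k), flagProj g x = .wFoot k →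
            π (embG h x) = 1 := by
          intro g h x k hx
          subst h
          exact wfoot_one hp t x k hx
        exact this _ h Q' k rfl
      rw [e1, e3, hc] at e2
      have e4 : clsWeight TClass.mge1 (t ∈ S) (GK.injuredT m j).order
        (edgeProj (.injuredT m j) (kedgeOf _ (Q k hk))) = 2 := rfl
      omega
    have tri : ∀ k : Fin m, π (embG h (G k.castSucc)) ≠ π (embG h (F k.succ)) ∧
        π (embG h (G k.castSucc)) ≠ 1 ∧ π (embG h (F k.succ)) ≠ 1 := by
      intro k
      by_cases hk : k = j
      · subst hk
        exact ⟨d3, fun e => d1 e.symm, fun e => d2 e.symm⟩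
      · have v1 : (embG h (G k.castSucc)).1.1 = (embG h (F k.succ)).1.1 :=
          (embG_vert h _ _).1 (by simp [kvert, tvert, F, G])
        have v2 : (embG h (G k.castSucc)).1.1 = (embG h (Q k hk)).1.1 :=
          (embG_vert h _ _).1 (by simp [kvert, tvert, Q, G])
        rw [← foot1 k hk]
        refine ⟨fun e => ?_, fun e => ?_, fun e => ?_⟩
        · cases congrArg (flagProj _) (embG_inj h (star_inj hs v1 e))
        · cases congrArg (flagProj _) (embG_inj h (star_inj hs v2 e))
        · cases congrArg (flagProj _) (embG_inj h (star_inj hs (v1.symm.trans v2) e))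
    have := num11 m (by omega) (fun i => if hi : i < m + 1 then π (embG h (F ⟨i, hi⟩)) else 0)
      (fun i => if hi : i < m + 1 then π (embG h (G ⟨i, hi⟩)) else 0) (fun _ => 1) ?_ ?_ ?_
      (fun _ _ => rfl)
    · simp only [dif_pos (show 0 < m + 1 by omega), dif_pos (show m < m + 1 by omega)] at this
      exact this
    · intro i hi
      simp only [dif_pos (show i < m + 1 by omega)]
      exact hw ⟨i, by simp only [GK.order]; omega⟩
    · intro i hi
      simp only [dif_pos (show i < m + 1 by omega), dif_pos (show i + 1 < m + 1 by omega)]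
      exact tri ⟨i, hi⟩
    · intro i hi
      simp only [dif_pos (show i < m + 1 by omega)]
      exact ⟨star_le hs _, star_le hs _⟩

theorem dclass {St : Setup} (hM : St.MatchingHyps) {S : Set St.ι} {π : Flag St.ends → ℕ}
    (hp : St.PiS S π) {t : St.ι} (ht : t ∈ St.DpiT π) :
    ∃ m, ∃ h : St.kind t = .openT m, DRel (St.cls t) m (t ∈ S) (fun x => π (oe h x)) := by
  obtain ⟨he, hn⟩ := ht
  have hn' : ¬ (π (St.emb t (headFlag _)) = 1 ∧ π (St.emb t (tailFlag _)) = 1) :=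
    fun h => hn ⟨he, h.1, h.2⟩
  have two : ∀ m (h : St.kind t = .openT m),
      (∀ a : ThreadEdge m, clsWeight (St.cls t) (t ∈ S) m a = 2) →
      (∀ x, π (oe h x) = (rho20 x : ℕ)) ∨ (∀ x, π (oe h x) = (rho02 x : ℕ)) := by
    intro m h hw
    obtain ⟨a, b, p, ha, hb, hpp, hv, hle, he, hf⟩ := oe_nat hp h
    have key := num2 m a b p (fun i hi => by rw [← hw (.e ⟨i, by omega⟩)]; exact he ⟨i, by omega⟩)
      hv hle (fun i hi => by
        have := hf ⟨i, hi⟩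
        rw [hw] at this
        simpa using this)
    have hp1 : ∀ k : Fin m, p k = 1 := by
      intro k
      have := hf k
      rw [hw] at this
      omega
    rcases key with h1 | h1 | h1
    · exfalso
      apply hn'
      rw [← oe_head h, ← oe_tail h, ha, hb]
      simpa using h1
    · left
      intro x
      cases x with
      | vLeft k => rw [ha, (h1 k (by omega)).1]; rfl
      | vRight k => rw [hb, (h1 k (by omega)).2]; rfl
      | vFoot k => rw [hpp, hp1]; rfl
      | wFoot k => exact (oe_wfoot hp h k).trans rfl
    · right
      intro x
      cases x with
      | vLeft k => rw [ha, (h1 k (by omega)).1]; rfl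
      | vRight k => rw [hb, (h1 k (by omega)).2]; rfl
      | vFoot k => rw [hpp, hp1]; rfl
      | wFoot k => exact (oe_wfoot hp h k).trans rfl
  rcases he with hc | hc | hc | hc | hc
  · have h := St.cls_m0 t hc
    exact ⟨0, h, Or.inr ⟨Or.inl ⟨hc, rfl⟩, by simp, two 0 h (by rw [hc]; intro a; rfl)⟩⟩
  · exact absurd (mge1_type hM hp hc) hn'
  · obtain ⟨m, hm, h⟩ := St.cls_dOdd t hc
    refine ⟨m, h, Or.inl ⟨hc, hm, ?_⟩⟩
    obtain ⟨a, b, p, ha, hb, hpp, hv, hle, he, hf⟩ := oe_nat hp h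
    rw [hc] at he hf
    by_cases hS : t ∈ S
    · left
      refine ⟨hS, ?_⟩
      simp only [clsWeight, if_pos hS] at he hf
      have hp1 : ∀ i < m, p i = if i = 0 then 2 else 1 := by
        intro i hi
        have := hf ⟨i, hi⟩
        simp only [w20] at this
        split_ifs at this ⊢ <;> omega
      have key := num20 m hm.pos a b p (fun i hi => he ⟨i, by omega⟩) hv hle hp1
      intro x
      cases x with
      | vLeft k => simp only [ha, (key k (by omega)).1, pi20]; split_ifs <;> rfl
      | vRight k => simp only [hb, (key k (by omega)).2, pi20]; split_ifs <;> rfl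
      | vFoot k => simp only [hpp, hp1 k k.2, pi20]; split_ifs <;> rfl
      | wFoot k => exact (oe_wfoot hp h k).trans rfl
    · right
      refine ⟨hS, ?_⟩
      simp only [clsWeight, if_neg hS] at he hf
      have hp1 : ∀ i < m, p i = if i = 0 then 2 else 1 := by
        intro i hi
        have := hf ⟨i, hi⟩
        simp only [w02] at this
        split_ifs at this ⊢ <;> omega
      have key := num02 m hm.pos a b p (fun i hi => he ⟨i, by omega⟩) hv hle hp1
      rcases key with key | key
      · exfalso
        apply hn'
        rw [← oe_head h, ← oe_tail h, ha, hb]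
        simpa using key
      · intro x
        cases x with
        | vLeft k => simp only [ha, (key k (by omega)).1, pi02]; rfl
        | vRight k => simp only [hb, (key k (by omega)).2, pi02]; split_ifs <;> rfl
        | vFoot k => simp only [hpp, hp1 k k.2, pi02]; split_ifs <;> rfl
        | wFoot k => exact (oe_wfoot hp h k).trans rfl
  · obtain ⟨m, hm, _, h⟩ := St.cls_dEven t hc
    exact ⟨m, h, Or.inr ⟨Or.inr (Or.inr hc), hm, two m h (by rw [hc]; intro a; rfl)⟩⟩
  · have h := St.cls_d0 t hc
    exact ⟨0, h, Or.inr ⟨Or.inr (Or.inl ⟨hc, rfl⟩), by simp, two 0 h (by rw [hc]; intro a; rfl)⟩⟩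

end Pf
end FLL

namespace FLL
namespace Pf

/-! #### The swap on a single thread -/

/-- `L'` is obtained from `L` by the swap on a thread of class `c` and order `m`. -/
def SwapRel (c : TClass) (m : ℕ) (inS : Prop) (L L' : ThreadFlag m → ℕ) : Prop :=
  (c = .dOdd ∧ Odd m ∧
    ((inS ∧ (∀ x, L x = (pi20 x : ℕ)) ∧ (∀ x, L' x = (pi02 x : ℕ))) ∨
     (¬ inS ∧ (∀ x, L x = (pi02 x : ℕ)) ∧ (∀ x, L' x = (pi20 x : ℕ))))) ∨
  (((c = .m0 ∧ m = 0) ∨ (c = .d0 ∧ m = 0) ∨ c = .dEven) ∧ Even m ∧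
    (((∀ x, L x = (rho20 x : ℕ)) ∧ (∀ x, L' x = (rho02 x : ℕ))) ∨
     ((∀ x, L x = (rho02 x : ℕ)) ∧ (∀ x, L' x = (rho20 x : ℕ)))))

/-- thread flags as a sum type -/
def tfEquiv (m : ℕ) : ThreadFlag m ≃ (Fin (m+1) ⊕ Fin (m+1)) ⊕ (Fin m ⊕ Fin m) where
  toFun
    | .vLeft k => .inl (.inl k)
    | .vRight k => .inl (.inr k)
    | .vFoot k => .inr (.inl k)
    | .wFoot k => .inr (.inr k)
  invFun
    | .inl (.inl k) => .vLeft k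
    | .inl (.inr k) => .vRight k
    | .inr (.inl k) => .vFoot k
    | .inr (.inr k) => .wFoot k
  left_inv x := by cases x <;> rfl
  right_inv x := by rcases x with (x | x) | (x | x) <;> rfl

instance (m : ℕ) : Fintype (ThreadFlag m) := Fintype.ofEquiv _ (tfEquiv m).symm

theorem tf_sum {m : ℕ} (F : ThreadFlag m → ℕ) :
    ∑ x, F x = (∑ k, F (.vLeft k) + ∑ k, F (.vRight k)) + (∑ k, F (.vFoot k) + ∑ k, F (.wFoot k)) := by
  rw [← (tfEquiv m).symm.sum_comp, Fintype.sum_sum_type, Fintype.sum_sum_type,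
    Fintype.sum_sum_type]; rfl

theorem sum_ne_one (m j : ℕ) (hj : j < m + 1) :
    ∑ k : Fin (m+1), (if (k : ℕ) = j then 0 else 1) = m := by
  have : ∑ k : Fin (m+1), ((if (k : ℕ) = j then 0 else 1) + if k = ⟨j, hj⟩ then 1 else 0) = m + 1 := by
    rw [Finset.sum_congr rfl (g := fun _ => 1)]
    · simp
    · intro k _
      by_cases h : (k : ℕ) = j
      · have : k = ⟨j, hj⟩ := Fin.ext h
        simp [this]
      · have : k ≠ ⟨j, hj⟩ := fun e => h (congrArg Fin.val e)
        simp [this, h]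
  rw [Finset.sum_add_distrib] at this
  simp only [Finset.sum_ite_eq', Finset.mem_univ, if_true] at this
  omega

section swaprel
variable {c : TClass} {m : ℕ} {inS : Prop} {L L' : ThreadFlag m → ℕ}

theorem SwapRel.drel (h : SwapRel c m inS L L') : DRel c m inS L := by
  unfold SwapRel at h; unfold DRel; tauto

theorem SwapRel.wfoot (h : SwapRel c m inS L L') (k : Fin m) : L (.wFoot k) = 1 ∧ L' (.wFoot k) = 1 := by
  rcases h with ⟨_, _, ⟨_, h1, h2⟩ | ⟨_, h1, h2⟩⟩ | ⟨_, _, ⟨h1, h2⟩ | ⟨h1, h2⟩⟩ <;>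
    rw [h1, h2] <;> exact ⟨rfl, rfl⟩

theorem SwapRel.head (h : SwapRel c m inS L L') :
    L (.vLeft 0) ≠ 1 ∧ L' (.vLeft 0) = 2 - L (.vLeft 0) := by
  rcases h with ⟨_, _, ⟨_, h1, h2⟩ | ⟨_, h1, h2⟩⟩ | ⟨_, _, ⟨h1, h2⟩ | ⟨h1, h2⟩⟩ <;>
    rw [h1, h2] <;> simp [rho20, rho02, pi20, pi02]

theorem SwapRel.tail (h : SwapRel c m inS L L') :
    L (.vRight (Fin.last m)) ≠ 1 ∧ L' (.vRight (Fin.last m)) = 2 - L (.vRight (Fin.last m)) := by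
  rcases h with ⟨_, hm, ⟨_, h1, h2⟩ | ⟨_, h1, h2⟩⟩ | ⟨_, _, ⟨h1, h2⟩ | ⟨h1, h2⟩⟩ <;>
    rw [h1, h2]
  · have := hm.pos.ne'
    simp [pi20, pi02, this]
  · have := hm.pos.ne'
    simp [pi20, pi02, this]
  · simp [rho20, rho02]
  · simp [rho20, rho02]

theorem SwapRel.inner (h : SwapRel c m inS L L') (k : Fin m) :
    (L' (.vRight k.castSucc) = 2 - L (.vRight k.castSucc) ∧ L' (.vLeft k.succ) = 2 - L (.vLeft k.succ) ∧
      L' (.vFoot k) = 2 - L (.vFoot k)) ∨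
    (L' (.vRight k.castSucc) = L (.vRight k.castSucc) ∧ L' (.vLeft k.succ) = L (.vLeft k.succ) ∧
      L' (.vFoot k) = L (.vFoot k)) := by
  rcases h with ⟨_, hm, ⟨_, h1, h2⟩ | ⟨_, h1, h2⟩⟩ | ⟨_, _, ⟨h1, h2⟩ | ⟨h1, h2⟩⟩ <;>
    simp only [h1, h2]
  · by_cases hk : (k : ℕ) = 0
    · right; simp [pi20, pi02, hk]
    · left; simp [pi20, pi02, hk]
  · by_cases hk : (k : ℕ) = 0
    · right; simp [pi20, pi02, hk]
    · left; simp [pi20, pi02, hk]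
  · left; simp [rho20, rho02]
  · left; simp [rho20, rho02]

theorem SwapRel.path (h : SwapRel c m inS L L') (k : Fin (m+1)) :
    L' (.vLeft k) + L' (.vRight k) = clsWeight c (¬ inS) m (.e k) := by
  rcases h with ⟨rfl, hm, ⟨hS, h1, h2⟩ | ⟨hS, h1, h2⟩⟩ | ⟨hc, _, ⟨h1, h2⟩ | ⟨h1, h2⟩⟩
  · simp only [h2, clsWeight, hS, pi02, w02, not_true, if_false]
    split_ifs <;> rfl
  · simp only [h2, clsWeight, hS, pi20, w20, not_false_iff, if_true]
    split_ifs <;> first | rfl | omega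
  all_goals
    rw [h2, h2]
    rcases hc with ⟨rfl, _⟩ | ⟨rfl, _⟩ | rfl <;> rfl

theorem SwapRel.foot (h : SwapRel c m inS L L') (k : Fin m) :
    L' (.vFoot k) + L' (.wFoot k) = clsWeight c (¬ inS) m (.f k) := by
  rcases h with ⟨rfl, hm, ⟨hS, h1, h2⟩ | ⟨hS, h1, h2⟩⟩ | ⟨hc, _, ⟨h1, h2⟩ | ⟨h1, h2⟩⟩
  · simp only [h2, clsWeight, hS, pi02, w02, not_true, if_false]
    split_ifs <;> rfl
  · simp only [h2, clsWeight, hS, pi20, w20, not_false_iff, if_true]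
    split_ifs <;> rfl
  all_goals
    rw [h2, h2]
    rcases hc with ⟨rfl, _⟩ | ⟨rfl, _⟩ | rfl <;> rfl

theorem SwapRel.count (h : SwapRel c m inS L L') :
    Odd (∑ x, if L x = 0 ∧ L' x = 2 then 1 else 0) := by
  rw [tf_sum]
  rcases h with ⟨rfl, hm, ⟨hS, h1, h2⟩ | ⟨hS, h1, h2⟩⟩ | ⟨hc, hm, ⟨h1, h2⟩ | ⟨h1, h2⟩⟩
  · have e : ∀ k : Fin (m+1), (if L (.vRight k) = 0 ∧ L' (.vRight k) = 2 then 1 else 0) =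
        if (k : ℕ) = 0 then 0 else 1 := by
      intro k
      rw [h1, h2]
      by_cases hk : (k : ℕ) = 0 <;> simp [pi20, pi02, hk]
    simp only [e]
    rw [sum_ne_one m 0 (by omega)]
    simp only [h1, h2]
    have e2 : ∀ k : Fin m, ¬ (((pi20 (.vFoot k) : Fin 3) : ℕ) = 0 ∧ ((pi02 (.vFoot k) : Fin 3) : ℕ) = 2) := by
      intro k
      by_cases hk : (k : ℕ) = 0 <;> simp [pi20, hk]
    simp only [e2]
    simpa [pi20, pi02] using hm
  · have e : ∀ k : Fin (m+1), (if L (.vLeft k) = 0 ∧ L' (.vLeft k) = 2 then 1 else 0) =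
        if (k : ℕ) = 1 then 0 else 1 := by
      intro k
      rw [h1, h2]
      by_cases hk : (k : ℕ) = 1 <;> simp [pi20, pi02, hk]
    simp only [e]
    rw [sum_ne_one m 1 (by have := hm.pos; omega)]
    simp only [h1, h2]
    have e2 : ∀ k : Fin m, ¬ (((pi02 (.vFoot k) : Fin 3) : ℕ) = 0 ∧ ((pi20 (.vFoot k) : Fin 3) : ℕ) = 2) := by
      intro k
      by_cases hk : (k : ℕ) = 0 <;> simp [pi02, hk]
    have e3 : ∀ k : Fin (m+1), ¬ (((pi02 (.vRight k) : Fin 3) : ℕ) = 0 ∧ ((pi20 (.vRight k) : Fin 3) : ℕ) = 2) := by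
      intro k
      by_cases hk : (k : ℕ) = 0 <;> simp [pi02, hk]
    simp only [e2, e3]
    simpa [pi20, pi02] using hm
  · simp only [h1, h2]
    simpa [rho20, rho02] using hm.add_one
  · simp only [h1, h2]
    simpa [rho20, rho02] using hm.add_one

end swaprel

end Pf
end FLL

namespace FLL
namespace Pf

/-! #### The swap on a component -/

/-- `π'` is obtained from `π ∈ Π_S` by swapping on the component `C` of `D_π`. -/
structure SwapOn (St : Setup) (C S : Set St.ι) (π π' : Flag St.ends → ℕ) : Prop where
  mem : St.PiS S π
  comp : St.IsOddCycleComponent (St.DpiT π) C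
  out : ∀ t, t ∉ C → ∀ kf, π' (St.emb t kf) = π (St.emb t kf)
  rel : ∀ t ∈ C, ∃ m, ∃ h : St.kind t = .openT m,
    SwapRel (St.cls t) m (t ∈ S) (fun x => π (oe h x)) (fun x => π' (oe h x))

theorem swapOn_of_clauses {St : Setup} (hM : St.MatchingHyps) {C S : Set St.ι}
    {π π' : Flag St.ends → ℕ} (hp : St.PiS S π) (hC : St.IsOddCycleComponent (St.DpiT π) C)
    (h0 : ∀ fl : FLL.Flag St.ends,
      (∀ t ∈ C, ∀ kf : KFlag (St.kind t), St.emb t kf ≠ fl) → π' fl = π fl)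
    (h1 : ∀ t ∈ C, (St.kind t).order = 0 →
      ∀ kf : KFlag (St.kind t), π' (St.emb t kf) = 2 - π (St.emb t kf))
    (h2 : ∀ t ∈ C, St.cls t = TClass.dOdd →
      (St.RestrEq t π (fun _ => pi20) → St.RestrEq t π' (fun _ => pi02)) ∧
      (St.RestrEq t π (fun _ => pi02) → St.RestrEq t π' (fun _ => pi20)))
    (h3 : ∀ t ∈ C, St.cls t = TClass.dEven →
      (St.RestrEq t π (fun _ => rho20) → St.RestrEq t π' (fun _ => rho02)) ∧
      (St.RestrEq t π (fun _ => rho02) → St.RestrEq t π' (fun _ => rho20))) :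
    SwapOn St C S π π' := by
  refine ⟨hp, hC, ?_, ?_⟩
  · intro t ht kf
    apply h0
    intro t' ht' kf' e
    rw [emb_thread_unique e] at ht'
    exact ht ht'
  · intro t ht
    obtain ⟨m, h, hd⟩ := dclass hM hp (hC.2.1 ht)
    refine ⟨m, h, ?_⟩
    have zero : m = 0 → ((∀ x, π (oe h x) = (rho20 x : ℕ)) ∨ (∀ x, π (oe h x) = (rho02 x : ℕ))) →
        ((∀ x, π (oe h x) = (rho20 x : ℕ)) ∧ (∀ x, π' (oe h x) = (rho02 x : ℕ))) ∨
        ((∀ x, π (oe h x) = (rho02 x : ℕ)) ∧ (∀ x, π' (oe h x) = (rho20 x : ℕ))) := by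
      intro hm hd
      have hz : ∀ x, π' (oe h x) = 2 - π (oe h x) := fun x =>
        h1 t ht (by rw [h]; exact hm) _
      rcases hd with hd | hd
      · left
        refine ⟨hd, fun x => ?_⟩
        rw [hz, hd]
        cases x <;> rfl
      · right
        refine ⟨hd, fun x => ?_⟩
        rw [hz, hd]
        cases x <;> rfl
    rcases hd with ⟨hc, hm, hd⟩ | ⟨hc, hm, hd⟩
    · left
      refine ⟨hc, hm, ?_⟩
      obtain ⟨ha, hb⟩ := h2 t ht hc
      rw [restrEq_iff h, restrEq_iff h] at ha hb
      rcases hd with ⟨hS, hd⟩ | ⟨hS, hd⟩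
      · exact Or.inl ⟨hS, hd, ha hd⟩
      · exact Or.inr ⟨hS, hd, hb hd⟩
    · right
      refine ⟨hc, hm, ?_⟩
      rcases hc with ⟨hc, h0⟩ | ⟨hc, h0⟩ | hc
      · exact zero h0 hd
      · exact zero h0 hd
      · obtain ⟨ha, hb⟩ := h3 t ht hc
        rw [restrEq_iff h, restrEq_iff h] at ha hb
        rcases hd with hd | hd
        · exact Or.inl ⟨hd, ha hd⟩
        · exact Or.inr ⟨hd, hb hd⟩

theorem clsWeight_congr {c : TClass} {P Q : Prop} (m : ℕ) (h : c = .dOdd → (P ↔ Q)) :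
    clsWeight c P m = clsWeight c Q m := by
  cases c <;> try rfl
  rw [propext (h rfl)]

section swapon
variable {St : Setup} {C S : Set St.ι} {π π' : Flag St.ends → ℕ}

theorem SwapOn.ends (hw : SwapOn St C S π π') {t : St.ι} (ht : t ∈ C) :
    (π (St.emb t (headFlag _)) ≠ 1 ∧
      π' (St.emb t (headFlag _)) = 2 - π (St.emb t (headFlag _))) ∧
    (π (St.emb t (tailFlag _)) ≠ 1 ∧
      π' (St.emb t (tailFlag _)) = 2 - π (St.emb t (tailFlag _))) := by
  obtain ⟨m, h, hr⟩ := hw.rel t ht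
  rw [← oe_head h, ← oe_tail h]
  exact ⟨hr.head, hr.tail⟩

theorem SwapOn.branch (hM : St.MatchingHyps) (hw : SwapOn St C S π π') {t : St.ι} (ht : t ∈ C)
    {fl : Flag St.ends} (hv : fl.1.1 = St.headV t ∨ fl.1.1 = St.tailV t) :
    π' fl = 2 - π fl := by
  have het : St.isEdgeThread t := hw.comp.1.1 t ht
  have hb : fl.1.1 ∈ St.branchV := ⟨t, het, by tauto⟩
  obtain ⟨t', he', hfl⟩ := branch_flags hM hw.mem.1 hb
  have hd := hw.comp.2.2 t ht t'
  by_cases hC : t' ∈ C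
  · rcases hfl with rfl | rfl
    · exact (hw.ends hC).1.2
    · exact (hw.ends hC).2.2
  · have hn : t' ∉ St.DpiT π := by
      intro hD
      apply hC
      apply hd hD
      rcases hfl with rfl | rfl
      · rcases hv with hv | hv
        · exact Or.inl hv
        · exact Or.inr (Or.inl hv)
      · rcases hv with hv | hv
        · exact Or.inr (Or.inr (Or.inl hv))
        · exact Or.inr (Or.inr (Or.inr hv))
    have hm : t' ∈ St.MpiT π := by
      by_contra hm
      exact hn ⟨he', hm⟩
    have := hm.2
    rcases hfl with rfl | rfl <;> rw [hw.out t' hC] <;> omega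

theorem SwapOn.dich (hM : St.MatchingHyps) (hw : SwapOn St C S π π') (v : St.V) :
    (∀ fl : Flag St.ends, fl.1.1 = v → π' fl = 2 - π fl) ∨
    (∀ fl : Flag St.ends, fl.1.1 = v → π' fl = π fl) := by
  by_cases hall : ∀ fl : Flag St.ends, fl.1.1 = v → π' fl = π fl
  · exact Or.inr hall
  push Not at hall
  obtain ⟨fl, hv, hne⟩ := hall
  obtain ⟨t, kf, rfl⟩ := flag_exists fl
  have ht : t ∈ C := by
    by_contra ht
    exact hne (hw.out t ht kf)
  obtain ⟨m, h, hr⟩ := hw.rel t ht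
  obtain ⟨x, hx⟩ := oe_exists h kf
  rw [hx] at hv hne
  have inner : ∀ k : Fin m, tvert x = tvert (.vRight k.castSucc : ThreadFlag m) →
    (∀ fl : Flag St.ends, fl.1.1 = v → π' fl = 2 - π fl) ∨
    (∀ fl : Flag St.ends, fl.1.1 = v → π' fl = π fl) := by
    intro k hk
    rw [oe_vert h, hv] at hk
    have key := fun u (hu : u.1.1 = v) => oe_tri_all hw.mem.1 h k u (hu.trans hk)
    rcases hr.inner k with ⟨a, b, c⟩ | ⟨a, b, c⟩
    · left
      intro u hu
      rcases key u hu with rfl | rfl | rfl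
      exacts [a, b, c]
    · right
      intro u hu
      rcases key u hu with rfl | rfl | rfl
      exacts [a, b, c]
  cases x with
  | vLeft k =>
    cases k using Fin.cases with
    | zero =>
      left
      intro u hu
      apply hw.branch hM ht
      left
      rw [hu, ← hv, oe_head]; rfl
    | succ k => exact inner k (by simp [tvert])
  | vRight k =>
    cases k using Fin.lastCases with
    | last =>
      left
      intro u hu
      apply hw.branch hM ht
      right
      rw [hu, ← hv, oe_tail]; rfl
    | cast k => exact inner k (by simp [tvert])
  | vFoot k => exact inner k (by simp [tvert])
  | wFoot k =>
    exfalso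
    have := hr.wfoot k
    omega

theorem SwapOn.one_iff (hM : St.MatchingHyps) (hw : SwapOn St C S π π') (fl : Flag St.ends) :
    π' fl = 1 ↔ π fl = 1 := by
  have := star_le hw.mem.1 fl
  rcases hw.dich hM fl.1.1 with h | h
  · rw [h fl rfl]; omega
  · rw [h fl rfl]

theorem SwapOn.mpi (hM : St.MatchingHyps) (hw : SwapOn St C S π π') : St.MpiT π' = St.MpiT π := by
  unfold Setup.MpiT
  simp only [hw.one_iff hM]

theorem SwapOn.dpi (hM : St.MatchingHyps) (hw : SwapOn St C S π π') : St.DpiT π' = St.DpiT π := by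
  unfold Setup.DpiT
  rw [hw.mpi hM]

theorem SwapOn.star (hM : St.MatchingHyps) (hw : SwapOn St C S π π') :
    IsStarLabelling St.ends π' := by
  intro v
  have hv := hw.mem.1 v
  rcases hw.dich hM v with h | h
  · have : (Finset.univ.filter (fun fl : Flag St.ends => fl.1.1 = v)).image π' =
        ((Finset.univ.filter (fun fl : Flag St.ends => fl.1.1 = v)).image π).image (fun n => 2 - n) := by
      rw [Finset.image_image]
      apply Finset.image_congr
      intro fl hfl
      exact h fl (by simpa using hfl)
    rw [this, hv, St.cubic]
    decide
  · rw [← hv]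
    apply Finset.image_congr
    intro fl hfl
    exact h fl (by simpa using hfl)

/-- the new set `S'` -/
def newS (St : Setup) (C S : Set St.ι) : Set St.ι := {t | St.cls t = .dOdd ∧ (t ∈ C ↔ t ∉ S)}

theorem SwapOn.piS (hM : St.MatchingHyps) (hS : ∀ t ∈ S, St.cls t = .dOdd)
    (hw : SwapOn St C S π π') : St.PiS (newS St C S) π' := by
  refine ⟨hw.star hM, fun t => ?_⟩
  by_cases ht : t ∈ C
  · obtain ⟨m, h, hr⟩ := hw.rel t ht
    apply piS_of_G h
    have hcw : clsWeight (St.cls t) (t ∈ newS St C S) m = clsWeight (St.cls t) (¬ t ∈ S) m := by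
      apply clsWeight_congr
      intro hc
      simp [newS, hc, ht]
    intro a
    show exponent St.ends π' (eembG h a) = clsWeight (St.cls t) (t ∈ newS St C S) m a
    rw [hcw]
    rcases a with k | k
    · rw [← hr.path k]
      exact exp_G (g := .openT m) h π' (x := ThreadFlag.vLeft k) (y := ThreadFlag.vRight k)
        (by intro e; cases e) rfl
    · rw [← hr.foot k]
      exact exp_G (g := .openT m) h π' (x := ThreadFlag.vFoot k) (y := ThreadFlag.wFoot k)
        (by intro e; cases e) rfl
  · intro a
    have hcw : clsWeight (St.cls t) (t ∈ newS St C S) (St.kind t).order =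
        clsWeight (St.cls t) (t ∈ S) (St.kind t).order := by
      apply clsWeight_congr
      intro hc
      simp [newS, hc, ht]
    rw [hcw, ← hw.mem.2 t a]
    unfold exponent
    apply Finset.sum_congr rfl
    intro fl hfl
    simp only [Finset.mem_filter, Finset.mem_univ, true_and] at hfl
    obtain ⟨t', kf, rfl⟩ := flag_exists fl
    rw [St.emb_edge] at hfl
    have := congrArg Sigma.fst (@St.eemb_inj ⟨t', _⟩ ⟨t, a⟩ hfl)
    simp only at this
    subst this
    exact hw.out _ ht kf

theorem SwapOn.pi1 (hM : St.MatchingHyps) (hS : ∀ t ∈ S, St.cls t = .dOdd)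
    (hw : SwapOn St C S π π') (hb : ¬ St.DpiBipartite π) : St.Pi1 π' := by
  refine ⟨⟨newS St C S, fun t ht => ht.1, hw.piS hM hS⟩, ?_⟩
  unfold Setup.DpiBipartite
  rw [hw.dpi hM]
  exact hb

theorem SwapOn.nonempty (hw : SwapOn St C S π π') : ∃ t, t ∈ C := by
  obtain ⟨n, hn, vs, es, h⟩ := hw.comp.1.2
  exact ⟨es ⟨0, hn.pos⟩, h.2.2.1 _⟩

theorem SwapOn.ne (hw : SwapOn St C S π π') : π' ≠ π := by
  rintro rfl
  obtain ⟨t, ht⟩ := hw.nonempty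
  have := (hw.ends ht).1
  omega

theorem SwapOn.back {π'' : Flag St.ends → ℕ} (hw : SwapOn St C S π π')
    (hw' : SwapOn St C (newS St C S) π' π'') : π'' = π := by
  funext fl
  obtain ⟨t, kf, rfl⟩ := flag_exists fl
  by_cases ht : t ∈ C
  · obtain ⟨m, h, hr⟩ := hw.rel t ht
    obtain ⟨m', h', hr'⟩ := hw'.rel t ht
    have e := h.symm.trans h'
    cases e
    obtain ⟨x, hx⟩ := oe_exists h kf
    rw [hx]
    rcases hr with ⟨hc, hm, ⟨_, h1, h2⟩ | ⟨_, h1, h2⟩⟩ | ⟨hc, hm, ⟨h1, h2⟩ | ⟨h1, h2⟩⟩ <;>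
    rcases hr' with ⟨hc', hm', ⟨_, h1', h2'⟩ | ⟨_, h1', h2'⟩⟩ | ⟨hc', hm', ⟨h1', h2'⟩ | ⟨h1', h2'⟩⟩
    all_goals first
      | exact (h2' x).trans (h1 x).symm
      | (exfalso; rw [hc] at hc'; simp at hc'; done)
      | (exfalso; rw [hc'] at hc; simp at hc; done)
      | (exfalso
         have a := (h2 (.vLeft 0)).symm.trans (h1' (.vLeft 0))
         simp [pi20, pi02, rho20, rho02] at a)
  · rw [hw'.out t ht, hw.out t ht]

end swapon

end Pf
end FLL

namespace FLL
namespace Pf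

/-! #### The sign -/

theorem pairs_card (St : Setup) (v : St.V) :
    ((Finset.univ.filter (fun p : Flag St.ends × Flag St.ends =>
      p.1.1.1 = p.2.1.1 ∧ p.1.1.2 < p.2.1.2)).filter (fun p => p.1.1.1 = v)).card = 3 := by
  classical
  set A := Finset.univ.filter (fun fl : Flag St.ends => fl.1.1 = v) with hA
  set P := (Finset.univ.filter (fun p : Flag St.ends × Flag St.ends =>
      p.1.1.1 = p.2.1.1 ∧ p.1.1.2 < p.2.1.2)).filter (fun p => p.1.1.1 = v) with hP
  have hcA : A.card = 3 := flagsAt_card St v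
  have hoff : A.offDiag.card = 6 := by rw [Finset.offDiag_card, hcA]
  have hu : A.offDiag = P ∪ P.image Prod.swap := by
    ext ⟨x, y⟩
    simp only [hA, hP, Finset.mem_offDiag, Finset.mem_filter, Finset.mem_univ, true_and,
      Finset.mem_union, Finset.mem_image, Prod.exists, Prod.swap_prod_mk, Prod.mk.injEq]
    constructor
    · rintro ⟨hx, hy, hne⟩
      rcases lt_trichotomy x.1.2 y.1.2 with h | h | h
      · exact Or.inl ⟨⟨hx.trans hy.symm, h⟩, hx⟩
      · exact absurd (flag_ext (hx.trans hy.symm) h) hne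
      · exact Or.inr ⟨y, x, ⟨⟨hy.trans hx.symm, h⟩, hy⟩, rfl, rfl⟩
    · rintro (⟨⟨h1, h2⟩, h3⟩ | ⟨a, b, ⟨⟨h1, h2⟩, h3⟩, rfl, rfl⟩)
      · refine ⟨h3, h1 ▸ h3, ?_⟩
        rintro rfl
        exact lt_irrefl _ h2
      · refine ⟨h1 ▸ h3, h3, ?_⟩
        rintro rfl
        exact lt_irrefl _ h2
  have hdis : Disjoint P (P.image Prod.swap) := by
    rw [Finset.disjoint_left]
    rintro ⟨x, y⟩ h1 h2
    simp only [hP, Finset.mem_filter, Finset.mem_univ, true_and,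
      Finset.mem_image, Prod.exists, Prod.swap_prod_mk, Prod.mk.injEq] at h1 h2
    obtain ⟨a, b, ⟨⟨_, h2⟩, _⟩, rfl, rfl⟩ := h2
    exact lt_asymm h2 h1.1.2
  rw [hu, Finset.card_union_of_disjoint hdis,
    Finset.card_image_of_injective _ Prod.swap_injective] at hoff
  omega

section sgn
variable {St : Setup} {C S : Set St.ι} {π π' : Flag St.ends → ℕ}

open Classical in
theorem SwapOn.sign_eq (hM : St.MatchingHyps) (hw : SwapOn St C S π π') :
    starSign St.ends π' =
      (-1) ^ (Finset.univ.filter (fun v : St.V =>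
        ∀ fl : Flag St.ends, fl.1.1 = v → π' fl = 2 - π fl)).card * starSign St.ends π := by
  let ε : St.V → ℤ := fun v => if ∀ fl : Flag St.ends, fl.1.1 = v → π' fl = 2 - π fl then -1 else 1
  have hε : ∀ v, ε v ^ 3 = ε v := by
    intro v
    simp only [ε]
    split_ifs <;> norm_num
  have h1 : starSign St.ends π' =
      (∏ p ∈ Finset.univ.filter (fun p : Flag St.ends × Flag St.ends =>
      p.1.1.1 = p.2.1.1 ∧ p.1.1.2 < p.2.1.2), ε p.1.1.1) * starSign St.ends π := by
    unfold starSign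
    rw [← Finset.prod_mul_distrib]
    apply Finset.prod_congr rfl
    rintro ⟨x, y⟩ hp
    simp only [Finset.mem_filter, Finset.mem_univ, true_and] at hp
    simp only [ε]
    have hx := star_le hw.mem.1 x
    have hy := star_le hw.mem.1 y
    by_cases hf : ∀ fl : Flag St.ends, fl.1.1 = x.1.1 → π' fl = 2 - π fl
    · rw [if_pos hf, hf x rfl, hf y hp.1.symm]
      rw [neg_one_mul, ← Int.sign_neg]
      congr 1
      omega
    · have := (hw.dich hM x.1.1).resolve_left hf
      rw [if_neg hf, this x rfl, this y hp.1.symm, one_mul]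
  rw [h1]
  congr 1
  rw [← Finset.prod_fiberwise (g := fun p : Flag St.ends × Flag St.ends => p.1.1.1)]
  have h2 : ∀ v : St.V, ∏ p ∈ (Finset.univ.filter (fun p : Flag St.ends × Flag St.ends =>
      p.1.1.1 = p.2.1.1 ∧ p.1.1.2 < p.2.1.2)).filter (fun p => p.1.1.1 = v), ε p.1.1.1 = ε v := by
    intro v
    rw [Finset.prod_congr rfl (g := fun _ => ε v), Finset.prod_const, pairs_card, hε]
    intro p hp
    rw [(Finset.mem_filter.1 hp).2]
  rw [Finset.prod_congr rfl (fun v _ => h2 v)]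
  simp only [ε]
  rw [Finset.prod_ite]
  simp

open Classical in
theorem SwapOn.flip_card (hM : St.MatchingHyps) (hw : SwapOn St C S π π') :
    (Finset.univ.filter (fun v : St.V =>
        ∀ fl : Flag St.ends, fl.1.1 = v → π' fl = 2 - π fl)).card =
    (Finset.univ.filter (fun fl : Flag St.ends => π fl = 0 ∧ π' fl = 2)).card := by
  symm
  refine Finset.card_bij (fun fl _ => fl.1.1) ?_ ?_ ?_
  · intro fl hfl
    simp only [Finset.mem_filter, Finset.mem_univ, true_and] at hfl ⊢
    refine (hw.dich hM fl.1.1).resolve_right ?_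
    intro h
    have := h fl rfl
    omega
  · intro a ha b hb hab
    simp only [Finset.mem_filter, Finset.mem_univ, true_and] at ha hb
    exact star_inj hw.mem.1 hab (ha.1.trans hb.1.symm)
  · intro v hv
    simp only [Finset.mem_filter, Finset.mem_univ, true_and] at hv
    obtain ⟨fl, h1, h2⟩ := star_surj hw.mem.1 v 0 (by omega)
    refine ⟨fl, ?_, h1⟩
    simp only [Finset.mem_filter, Finset.mem_univ, true_and]
    exact ⟨h2, by rw [hv fl h1, h2]⟩

open Classical in
theorem SwapOn.odd_card (hw : SwapOn St C S π π') :
    Odd (Finset.univ.filter (fun fl : Flag St.ends => π fl = 0 ∧ π' fl = 2)).card := by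
  choose thr kf hthr using fun fl : Flag St.ends => flag_exists fl
  have hmaps : ∀ fl ∈ Finset.univ.filter (fun fl : Flag St.ends => π fl = 0 ∧ π' fl = 2),
      thr fl ∈ C.toFinset := by
    intro fl hfl
    simp only [Finset.mem_filter, Finset.mem_univ, true_and, Set.mem_toFinset] at hfl ⊢
    by_contra hn
    have := hw.out _ hn (kf fl)
    rw [hthr] at this
    omega
  rw [Finset.card_eq_sum_card_fiberwise hmaps, Finset.odd_sum_iff_odd_card_odd]
  have hodd : ∀ t ∈ C.toFinset, Odd ((Finset.univ.filter
      (fun fl : Flag St.ends => π fl = 0 ∧ π' fl = 2)).filter (fun fl => thr fl = t)).card := by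
    intro t ht
    obtain ⟨m, h, hr⟩ := hw.rel t (by simpa using ht)
    have hc := hr.count
    rw [← Finset.card_filter] at hc
    convert hc using 1
    symm
    refine Finset.card_bij (fun x _ => oe h x) ?_ ?_ ?_
    · intro x hx
      simp only [Finset.mem_filter, Finset.mem_univ, true_and] at hx ⊢
      exact ⟨hx, emb_thread_unique (hthr (oe h x))⟩
    · intro a _ b _ hab
      exact oe_inj h hab
    · intro fl hfl
      simp only [Finset.mem_filter, Finset.mem_univ, true_and] at hfl
      obtain ⟨hfl, rfl⟩ := hfl
      obtain ⟨x, hx⟩ := oe_exists h (kf fl)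
      rw [hthr] at hx
      refine ⟨x, ?_, hx.symm⟩
      simp only [Finset.mem_filter, Finset.mem_univ, true_and]
      rw [← hx]
      exact hfl
  rw [Finset.filter_true_of_mem hodd]
  obtain ⟨n, hn, vs, es, _, hinj, hmem, hsurj, _⟩ := hw.comp.1.2
  have : C.toFinset = Finset.univ.image es := by
    ext t
    simp only [Set.mem_toFinset, Finset.mem_image, Finset.mem_univ, true_and]
    constructor
    · exact hsurj t
    · rintro ⟨i, rfl⟩
      exact hmem i
  rw [this, Finset.card_image_of_injective _ hinj]
  simpa using hn

theorem SwapOn.sign (hM : St.MatchingHyps) (hw : SwapOn St C S π π') :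
    starSign St.ends π' = - starSign St.ends π := by
  rw [hw.sign_eq hM, hw.flip_card hM, hw.odd_card.neg_one_pow, neg_one_mul]

end sgn

end Pf
end FLL

namespace FLL
namespace Pf

/-! #### Existence of an odd cycle component -/

theorem perm_colour {α : Type} [Finite α] (σ : Equiv.Perm α)
    (hev : ∀ x, ¬ Odd (Function.minimalPeriod σ x)) :
    ∃ c : α → Bool, ∀ x, c (σ x) ≠ c x := by
  classical
  let r : α → α := fun x => (Quotient.mk (Equiv.Perm.SameCycle.setoid σ) x).out
  have hr : ∀ x, σ.SameCycle (r x) x := fun x =>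
    Quotient.exact (s := Equiv.Perm.SameCycle.setoid σ) (Quotient.out_eq _)
  have hrs : ∀ x, r (σ x) = r x := by
    intro x
    have : Quotient.mk (Equiv.Perm.SameCycle.setoid σ) (σ x) = Quotient.mk _ x :=
      Quotient.sound (s := Equiv.Perm.SameCycle.setoid σ)
        (Equiv.Perm.sameCycle_apply_left.2 (Equiv.Perm.SameCycle.refl σ x))
    simp only [r, this]
  have hpow : ∀ x, ∃ k : ℕ, σ^[k] (r x) = x := by
    intro x
    obtain ⟨i, hi⟩ := (hr x).exists_nat_pow_eq
    refine ⟨i, ?_⟩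
    rw [Equiv.Perm.iterate_eq_pow]
    exact hi
  refine ⟨fun x => decide (∃ k : ℕ, Even k ∧ σ^[k] (r x) = x), fun x => ?_⟩
  have hsucc : ∀ k, σ^[k] (r x) = x → σ^[k+1] (r x) = σ x := by
    intro k hk
    rw [Function.iterate_succ_apply', hk]
  intro heq
  rw [decide_eq_decide, hrs] at heq
  by_cases hc : ∃ k : ℕ, Even k ∧ σ^[k] (r x) = x
  · obtain ⟨k', hk', he'⟩ := heq.2 hc
    obtain ⟨k, hk, he⟩ := hc
    have e : σ^[k+1] (r x) = σ^[k'] (r x) := (hsucc k he).trans he'.symm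
    rw [← Function.iterate_mod_minimalPeriod_eq (n := k+1),
      ← Function.iterate_mod_minimalPeriod_eq (n := k')] at e
    have hpos : 0 < Function.minimalPeriod σ (r x) := by
      apply Function.minimalPeriod_pos_of_mem_periodicPts
      obtain ⟨n, hn, hn'⟩ := isOfFinOrder_iff_pow_eq_one.1 (isOfFinOrder_of_finite σ)
      refine Function.mk_mem_periodicPts hn ?_
      show σ^[n] (r x) = r x
      rw [Equiv.Perm.iterate_eq_pow, hn']
      rfl
    have e2 := Function.iterate_injOn_Iio_minimalPeriod (Nat.mod_lt _ hpos) (Nat.mod_lt _ hpos) e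
    have hp := Nat.not_odd_iff_even.1 (hev (r x))
    obtain ⟨q, hq⟩ := hp
    have m1 := Nat.div_add_mod (k+1) (Function.minimalPeriod σ (r x))
    have m2 := Nat.div_add_mod k' (Function.minimalPeriod σ (r x))
    rw [e2, hq] at m1
    rw [hq] at m2
    obtain ⟨a, ha⟩ := hk
    obtain ⟨b, hb⟩ := hk'
    have d1 : 2 ∣ (q + q) * ((k+1) / (q+q)) := ⟨q * ((k+1) / (q+q)), by ring⟩
    have d2 : 2 ∣ (q + q) * (k' / (q+q)) := ⟨q * (k' / (q+q)), by ring⟩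
    omega
  · obtain ⟨k, hk⟩ := hpow x
    have hodd : ¬ Even k := fun h => hc ⟨k, h, hk⟩
    exact hc (heq.1 ⟨k+1, (Nat.not_even_iff_odd.1 hodd).add_one, hsucc k hk⟩)

theorem odd_orbit {α : Type} [Finite α] (σ : Equiv.Perm α) (x : α)
    (hodd : Odd (Function.minimalPeriod σ x)) :
    ∃ n, Odd n ∧ ∃ es : Fin n → α, Function.Injective es ∧
      (∀ i, σ (es i) = es (finRotate n i)) ∧ (∀ y i, σ y = es i → ∃ j, y = es j) := by
  obtain ⟨n, hn⟩ : ∃ n, Function.minimalPeriod σ x = n + 1 := ⟨_, (Nat.succ_pred hodd.pos.ne').symm⟩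
  rw [hn] at hodd
  have hmod : ∀ k, σ^[k % (n+1)] x = σ^[k] x := by
    intro k; rw [← hn]; exact Function.iterate_mod_minimalPeriod_eq
  refine ⟨n+1, hodd, fun i => σ^[i] x, ?_, ?_, ?_⟩
  · intro i j hij
    apply Fin.ext
    have hi : (i : ℕ) ∈ Set.Iio (Function.minimalPeriod σ x) := by rw [hn]; exact i.2
    have hj : (j : ℕ) ∈ Set.Iio (Function.minimalPeriod σ x) := by rw [hn]; exact j.2
    exact Function.iterate_injOn_Iio_minimalPeriod hi hj hij
  · intro i
    show σ (σ^[(i : ℕ)] x) = σ^[((finRotate (n+1) i : Fin (n+1)) : ℕ)] x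
    rw [← Function.iterate_succ_apply' σ, coe_finRotate]
    split_ifs with h
    · subst h
      rw [← hmod]
      simp
    · rfl
  · intro y i h
    refine ⟨⟨(i + n) % (n+1), Nat.mod_lt _ (by omega)⟩, ?_⟩
    show y = σ^[((i : ℕ) + n) % (n+1)] x
    rw [hmod]
    apply σ.injective
    rw [h, ← Function.iterate_succ_apply' σ]
    show σ^[(i : ℕ)] x = σ^[(i : ℕ) + n + 1] x
    rw [← hmod ((i : ℕ) + n + 1), show (i : ℕ) + n + 1 = i + (n + 1) by ring, Nat.add_mod_right, hmod]

section dpi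
variable {St : Setup} {S : Set St.ι} {π : Flag St.ends → ℕ}

theorem dends (hM : St.MatchingHyps) (hp : St.PiS S π) {t : St.ι} (ht : t ∈ St.DpiT π) :
    (π (St.emb t (headFlag _)) = 2 ∧ π (St.emb t (tailFlag _)) = 0) ∨
    (π (St.emb t (headFlag _)) = 0 ∧ π (St.emb t (tailFlag _)) = 2) := by
  obtain ⟨m, h, hd⟩ := dclass hM hp ht
  rw [← oe_head h, ← oe_tail h]
  rcases hd with ⟨_, hm, ⟨_, h1⟩ | ⟨_, h1⟩⟩ | ⟨_, _, h1 | h1⟩ <;>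
    simp only at h1 <;> rw [h1, h1]
  · have := hm.pos.ne'
    left; simp [pi20, this]
  · have := hm.pos.ne'
    right; simp [pi02, this]
  · left; simp [rho20]
  · right; simp [rho02]

open Classical in
/-- the end of `t` labelled `0` -/
noncomputable def srcFl (St : Setup) (π : Flag St.ends → ℕ) (t : St.ι) : Flag St.ends :=
  if π (St.emb t (headFlag _)) = 0 then St.emb t (headFlag _) else St.emb t (tailFlag _)

open Classical in
/-- the end of `t` labelled `2` -/
noncomputable def tgtFl (St : Setup) (π : Flag St.ends → ℕ) (t : St.ι) : Flag St.ends :=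
  if π (St.emb t (headFlag _)) = 0 then St.emb t (tailFlag _) else St.emb t (headFlag _)

theorem srcFl_zero (hM : St.MatchingHyps) (hp : St.PiS S π) {t : St.ι} (ht : t ∈ St.DpiT π) :
    π (srcFl St π t) = 0 := by
  have := dends hM hp ht
  unfold srcFl
  split_ifs <;> omega

theorem tgtFl_two (hM : St.MatchingHyps) (hp : St.PiS S π) {t : St.ι} (ht : t ∈ St.DpiT π) :
    π (tgtFl St π t) = 2 := by
  have := dends hM hp ht
  unfold tgtFl
  split_ifs <;> omega

theorem srcFl_thread {t t' : St.ι} (h : srcFl St π t = srcFl St π t') : t = t' := by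
  unfold srcFl at h
  split_ifs at h <;> exact emb_thread_unique h

theorem tgtFl_thread {t t' : St.ι} (h : tgtFl St π t = tgtFl St π t') : t = t' := by
  unfold tgtFl at h
  split_ifs at h <;> exact emb_thread_unique h

theorem src_inj (hM : St.MatchingHyps) (hp : St.PiS S π) {t t' : St.ι} (ht : t ∈ St.DpiT π)
    (ht' : t' ∈ St.DpiT π) (h : (srcFl St π t).1.1 = (srcFl St π t').1.1) : t = t' :=
  srcFl_thread (star_inj hp.1 h ((srcFl_zero hM hp ht).trans (srcFl_zero hM hp ht').symm))

theorem tgt_inj (hM : St.MatchingHyps) (hp : St.PiS S π) {t t' : St.ι} (ht : t ∈ St.DpiT π)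
    (ht' : t' ∈ St.DpiT π) (h : (tgtFl St π t).1.1 = (tgtFl St π t').1.1) : t = t' :=
  tgtFl_thread (star_inj hp.1 h ((tgtFl_two hM hp ht).trans (tgtFl_two hM hp ht').symm))

theorem src_next (hM : St.MatchingHyps) (hp : St.PiS S π) {t : St.ι} (ht : t ∈ St.DpiT π) :
    ∃ t' ∈ St.DpiT π, (srcFl St π t').1.1 = (tgtFl St π t).1.1 := by
  have hb : (tgtFl St π t).1.1 ∈ St.branchV := by
    unfold tgtFl
    split_ifs
    · exact branch_tail ht.1
    · exact branch_head ht.1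
  obtain ⟨fl, hv, h0⟩ := star_surj hp.1 (tgtFl St π t).1.1 0 (by omega)
  rw [← hv] at hb
  obtain ⟨t', he, hfl⟩ := branch_flags hM hp.1 hb
  have hD : t' ∈ St.DpiT π := by
    refine ⟨he, fun hm => ?_⟩
    have := hm.2
    rcases hfl with rfl | rfl <;> omega
  refine ⟨t', hD, ?_⟩
  rw [← hv]
  have := dends hM hp hD
  unfold srcFl
  rcases hfl with rfl | rfl
  · rw [if_pos h0]
  · rw [if_neg (by omega)]

theorem src_tgt_sym (t : St.ι) :
    s(St.headV t, St.tailV t) = s((srcFl St π t).1.1, (tgtFl St π t).1.1) := by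
  unfold srcFl tgtFl Setup.headV Setup.tailV
  split_ifs
  · rfl
  · exact Sym2.eq_swap

theorem exists_component (hM : St.MatchingHyps) (hp : St.PiS S π) (hb : ¬ St.DpiBipartite π) :
    ∃ C, St.IsOddCycleComponent (St.DpiT π) C := by
  classical
  choose nx hnx1 hnx2 using fun t : St.DpiT π => src_next hM hp t.2
  have hinj : Function.Injective (fun t : St.DpiT π => (⟨nx t, hnx1 t⟩ : St.DpiT π)) := by
    intro a b hab
    have hab' : nx a = nx b := congrArg Subtype.val hab
    apply Subtype.ext
    apply tgt_inj hM hp a.2 b.2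
    rw [← hnx2, ← hnx2, hab']
  let σ : Equiv.Perm (St.DpiT π) := Equiv.ofBijective _ (Finite.injective_iff_bijective.1 hinj)
  have hσ : ∀ t : St.DpiT π, (srcFl St π (σ t)).1.1 = (tgtFl St π t).1.1 := hnx2
  by_cases hodd : ∃ x, Odd (Function.minimalPeriod σ x)
  · obtain ⟨x, hx⟩ := hodd
    obtain ⟨n, hn, es, hes, hrot, hback⟩ := odd_orbit σ x hx
    refine ⟨Set.range (fun i => (es i : St.ι)), ⟨?_, n, hn, fun i => (srcFl St π (es i)).1.1,
      fun i => es i, ?_, ?_, ?_, ?_, ?_⟩, ?_, ?_⟩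
    · rintro _ ⟨i, rfl⟩
      exact (es i).2.1
    · intro i j hij
      exact hes (Subtype.ext (src_inj hM hp (es i).2 (es j).2 hij))
    · intro i j hij
      exact hes (Subtype.ext hij)
    · intro i; exact ⟨i, rfl⟩
    · rintro _ ⟨i, rfl⟩; exact ⟨i, rfl⟩
    · intro i
      rw [src_tgt_sym (π := π), ← hσ, hrot]
    · rintro _ ⟨i, rfl⟩
      exact (es i).2
    · rintro _ ⟨i, rfl⟩ t' ht' hsh
      have key : ∀ v : St.V, (v = St.headV t' ∨ v = St.tailV t') →
          (v = St.headV (es i) ∨ v = St.tailV (es i)) → t' ∈ Set.range (fun i => (es i : St.ι)) := by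
        intro v h1 h2
        rw [← Sym2.mem_iff, src_tgt_sym (π := π), Sym2.mem_iff] at h1 h2
        have h2' : ∃ j, v = (srcFl St π (es j)).1.1 := by
          rcases h2 with h2 | h2
          · exact ⟨i, h2⟩
          · exact ⟨finRotate n i, by rw [h2, ← hrot, hσ]⟩
        obtain ⟨j, hj⟩ := h2'
        rcases h1 with h1 | h1
        · exact ⟨j, (src_inj hM hp ht' (es j).2 (h1.symm.trans hj)).symm⟩
        · have h3 := hσ ⟨t', ht'⟩
          have h4 : σ ⟨t', ht'⟩ = es j := Subtype.ext
            (src_inj hM hp (σ _).2 (es j).2 (h3.trans (h1.symm.trans hj)))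
          obtain ⟨k, hk⟩ := hback _ _ h4
          exact ⟨k, (congrArg Subtype.val hk).symm⟩
      rcases hsh with h | h | h | h
      · exact key _ (Or.inl rfl) (Or.inl h)
      · exact key _ (Or.inl rfl) (Or.inr h)
      · exact key _ (Or.inr rfl) (Or.inl h)
      · exact key _ (Or.inr rfl) (Or.inr h)
  · exfalso
    apply hb
    push Not at hodd
    obtain ⟨c, hc⟩ := perm_colour σ (fun x => by simpa using hodd x)
    let d : St.V → Bool := fun v =>
      if h : ∃ t : St.DpiT π, (srcFl St π t).1.1 = v then c h.choose else false
    have hd : ∀ t : St.DpiT π, d (srcFl St π t).1.1 = c t := by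
      intro t
      have h : ∃ t' : St.DpiT π, (srcFl St π t').1.1 = (srcFl St π t).1.1 := ⟨t, rfl⟩
      simp only [d, dif_pos h]
      congr 1
      exact Subtype.ext (src_inj hM hp h.choose.2 t.2 h.choose_spec)
    refine ⟨d, fun t ht => ?_⟩
    have h1 : d (srcFl St π t).1.1 ≠ d (tgtFl St π t).1.1 := by
      rw [hd ⟨t, ht⟩, ← hσ ⟨t, ht⟩, hd]
      exact (hc _).symm
    have h2 := src_tgt_sym (π := π) t
    rcases Sym2.eq_iff.1 h2 with ⟨a, b⟩ | ⟨a, b⟩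
    · rw [a, b]; exact h1
    · rw [a, b]; exact h1.symm

end dpi

end Pf
end FLL

namespace FLL
namespace Pf

/-! #### Existence of the swap -/

theorem flagProj_head (g : GK) : flagProj g (headFlag g) = .vLeft 0 := by cases g <;> rfl

theorem local_swap {St : Setup} (π : Flag St.ends → ℕ) (t : St.ι) :
    ∃ L : KFlag (St.kind t) → ℕ,
      ((St.kind t).order = 0 → ∀ kf, L kf = 2 - π (St.emb t kf)) ∧
      (St.cls t = TClass.dOdd →
        (St.RestrEq t π (fun _ => pi20) → ∀ kf, L kf = (pi02 (flagProj _ kf) : ℕ)) ∧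
        (St.RestrEq t π (fun _ => pi02) → ∀ kf, L kf = (pi20 (flagProj _ kf) : ℕ))) ∧
      (St.cls t = TClass.dEven →
        (St.RestrEq t π (fun _ => rho20) → ∀ kf, L kf = (rho02 (flagProj _ kf) : ℕ)) ∧
        (St.RestrEq t π (fun _ => rho02) → ∀ kf, L kf = (rho20 (flagProj _ kf) : ℕ))) := by
  by_cases h0 : (St.kind t).order = 0
  · refine ⟨fun kf => 2 - π (St.emb t kf), fun _ _ => rfl, fun hc => ?_, fun hc => ?_⟩
    · obtain ⟨m, hm, h⟩ := St.cls_dOdd t hc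
      rw [h] at h0
      exact absurd h0 hm.pos.ne'
    · obtain ⟨m, hm, h2, h⟩ := St.cls_dEven t hc
      rw [h] at h0
      have : m = 0 := h0
      omega
  have ex1 : St.RestrEq t π (fun _ => pi20) → St.RestrEq t π (fun _ => pi02) → False := by
    intro h1 h2
    have := (h1 (headFlag _)).symm.trans (h2 (headFlag _))
    rw [flagProj_head] at this
    simp [pi20, pi02] at this
  have ex2 : St.RestrEq t π (fun _ => rho20) → St.RestrEq t π (fun _ => rho02) → False := by
    intro h1 h2
    have := (h1 (headFlag _)).symm.trans (h2 (headFlag _))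
    rw [flagProj_head] at this
    simp [rho20, rho02] at this
  by_cases hc : St.cls t = .dOdd
  · by_cases hr : St.RestrEq t π (fun _ => pi20)
    · refine ⟨fun kf => (pi02 (flagProj _ kf) : ℕ), fun h => absurd h h0, fun _ => ⟨fun _ _ => rfl,
        fun h => (ex1 hr h).elim⟩, fun h => ?_⟩
      rw [hc] at h; cases h
    · refine ⟨fun kf => (pi20 (flagProj _ kf) : ℕ), fun h => absurd h h0,
        fun _ => ⟨fun h => absurd h hr, fun _ _ => rfl⟩, fun h => ?_⟩
      rw [hc] at h; cases h
  · by_cases hr : St.RestrEq t π (fun _ => rho20)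
    · exact ⟨fun kf => (rho02 (flagProj _ kf) : ℕ), fun h => absurd h h0, fun h => absurd h hc,
        fun _ => ⟨fun _ _ => rfl, fun h => (ex2 hr h).elim⟩⟩
    · exact ⟨fun kf => (rho20 (flagProj _ kf) : ℕ), fun h => absurd h h0, fun h => absurd h hc,
        fun _ => ⟨fun h => absurd h hr, fun _ _ => rfl⟩⟩

theorem swapSpec_exists {St : Setup} (hM : St.MatchingHyps) (rk : Set St.ι → ℕ)
    {π : Flag St.ends → ℕ} (h1 : St.Pi1 π) : ∃ π', SwapSpec St rk π π' := by
  classical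
  obtain ⟨⟨S, hS, hp⟩, hb⟩ := h1
  obtain ⟨C, hC, hmin⟩ := Set.exists_min_image {C | St.IsOddCycleComponent (St.DpiT π) C} rk
    (Set.toFinite _) (exists_component hM hp hb)
  choose L hL0 hL1 hL2 using fun t => local_swap π t
  choose p hp1 hp2 using fun fl : Flag St.ends => St.flag_partition fl
  let π' : Flag St.ends → ℕ := fun fl => if (p fl).1 ∈ C then L (p fl).1 (p fl).2 else π fl
  have hπ' : ∀ t ∈ C, ∀ kf, π' (St.emb t kf) = L t kf := by
    intro t ht kf
    have e : (⟨t, kf⟩ : Σ t : St.ι, KFlag (St.kind t)) = p (St.emb t kf) := hp2 _ ⟨t, kf⟩ rfl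
    simp only [π']
    rw [← e]
    exact if_pos ht
  refine ⟨π', C, hC, fun C' hC' => hmin C' hC', ?_, ?_, ?_, ?_⟩
  · intro fl hfl
    exact if_neg (fun h => hfl _ h _ (hp1 fl))
  · intro t ht h0 kf
    rw [hπ' t ht, hL0 t h0]
  · intro t ht hc
    exact ⟨fun h kf => (hπ' t ht kf).trans ((hL1 t hc).1 h kf),
      fun h kf => (hπ' t ht kf).trans ((hL1 t hc).2 h kf)⟩
  · intro t ht hc
    exact ⟨fun h kf => (hπ' t ht kf).trans ((hL2 t hc).1 h kf),
      fun h kf => (hπ' t ht kf).trans ((hL2 t hc).2 h kf)⟩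

end Pf
end FLL

/-- Proposition 5.7.  Fix a total ordering of the odd cycles of `Ḡ`
(an injective rank function on them) and let `f : Π_1 → Π_1` be the map described in
`SwapSpec`.  Then `f` is well defined (such a map exists), and any map so described is a
fixed-point-free involution of `Π_1` with `sgn(f(π)) = −sgn(π)` for all `π ∈ Π_1`. -/
theorem statement17 (St : FLL.Setup) (hM : St.MatchingHyps)
    (rk : Set St.ι → ℕ) (hrk : Set.InjOn rk {C | St.IsOddCycle C}) :
    (∃ F : (FLL.Flag St.ends → ℕ) → (FLL.Flag St.ends → ℕ),
      ∀ π, St.Pi1 π → SwapSpec St rk π (F π)) ∧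
    (∀ F : (FLL.Flag St.ends → ℕ) → (FLL.Flag St.ends → ℕ),
      (∀ π, St.Pi1 π → SwapSpec St rk π (F π)) →
      ∀ π, St.Pi1 π →
        St.Pi1 (F π) ∧ F (F π) = π ∧ F π ≠ π ∧
        FLL.starSign St.ends (F π) = - FLL.starSign St.ends π) := by
  classical
  refine ⟨?_, ?_⟩
  · refine ⟨fun π => if h : St.Pi1 π then (FLL.Pf.swapSpec_exists hM rk h).choose else π, ?_⟩
    intro π hπ
    simp only [dif_pos hπ]
    exact (FLL.Pf.swapSpec_exists hM rk hπ).choose_spec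
  · intro F hF π hπ
    obtain ⟨C, hC, hmin, a0, a1, a2, a3⟩ := hF π hπ
    obtain ⟨⟨S, hS, hp⟩, hb⟩ := hπ
    have hw := FLL.Pf.swapOn_of_clauses hM hp hC a0 a1 a2 a3
    have h1 : St.Pi1 (F π) := hw.pi1 hM hS hb
    refine ⟨h1, ?_, hw.ne, hw.sign hM⟩
    obtain ⟨C', hC', hmin', b0, b1, b2, b3⟩ := hF (F π) h1
    have hD := hw.dpi hM
    have hCC : C' = C := by
      apply hrk hC'.1 hC.1
      rw [hD] at hC' hmin'
      exact le_antisymm (hmin' C hC) (hmin C' hC')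
    subst hCC
    have hw' := FLL.Pf.swapOn_of_clauses hM (hw.piS hM hS) hC' b0 b1 b2 b3
    exact hw.back hw'
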